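/- arXiv:0706.3237 — 3 statements merged into one kernel-verified Lean document; each statement's English description precedes it below -/
import Mathlib

section
/- Let n ≥ 3 and define h(x) = (1/((2−n)ωₙ M))·[ Q2·Σ_{m=0}^{∞} (−1)^m q_{1,m}^{n−2}/|x − c_{1,m}|^{n−2} − Q1·Σ_{m=0}^{∞} (−1)^m q_{2,m}^{n−2}/|x − c_{2,m}|^{n−2} ], where ωₙ is the surface area of the unit sphere in ℝⁿ. Then h is well defined (both series converge absolutely) and h solves the dual problem: h is harmonic in ℝⁿ∖(cl D1 ∪ cl D2), h(x) = O(|x|^{1−n}) as |x|→∞, h is constant on ∂D1 and constant on ∂D2, and ∫_{∂D1} ∂_ν h dS = 1, ∫_{∂D2} ∂_ν h dS = −1, where ν is the unit normal on ∂D_i pointing out of D_i and dS the surface measure. -/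
open MeasureTheory Metric Filter Asymptotics
open scoped RealInnerProductSpace Topology

noncomputable section

/-- `n`-dimensional Euclidean space. -/
abbrev ES (n : ℕ) : Type := EuclideanSpace ℝ (Fin n)

/-- The Laplacian of `u` at `x`: the sum of the pure second partial derivatives. -/
def lap {n : ℕ} (u : ES n → ℝ) (x : ES n) : ℝ :=
  ∑ i : Fin n,
    fderiv ℝ (fun y => fderiv ℝ u y (EuclideanSpace.single i 1)) x (EuclideanSpace.single i 1)

/-- `u` is harmonic on `s`: it is twice differentiable and its Laplacian vanishes on `s`. -/
def HarmOn {n : ℕ} (u : ES n → ℝ) (s : Set (ES n)) : Prop :=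
  ContDiffOn ℝ 2 u s ∧ ∀ x ∈ s, lap u x = 0

/-- `∫_{∂B_r(c)} (∂_ν u) · w dS` : the integral over the sphere of radius `r` centered at `c`
of the outward normal derivative of `u` times the weight `w`, with respect to the
`(n-1)`-dimensional Hausdorff (surface) measure. -/
def fluxW {n : ℕ} (u w : ES n → ℝ) (c : ES n) (r : ℝ) : ℝ :=
  ∫ x in sphere c r, (⟪gradient u x, r⁻¹ • (x - c)⟫ * w x) ∂(μH[(n - 1 : ℝ)])

/-- `∫_{∂B_r(c)} ∂_ν u dS` : the total outward flux of `u` through the sphere. -/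
def flux {n : ℕ} (u : ES n → ℝ) (c : ES n) (r : ℝ) : ℝ :=
  fluxW u (fun _ => 1) c r

/-- `u` solves the conductivity problem for the entire harmonic function `H` and the
perfect conductors `B(c₁,r₁)`, `B(c₂,r₂)`, taking the constant values `v₁`, `v₂` on the
respective boundary spheres. -/
structure IsCondSol {n : ℕ} (c₁ c₂ : ES n) (r₁ r₂ : ℝ) (H u : ES n → ℝ)
    (v₁ v₂ : ℝ) : Prop where
  cont : ContinuousOn u (ball c₁ r₁ ∪ ball c₂ r₂)ᶜ
  harm : HarmOn u (closedBall c₁ r₁ ∪ closedBall c₂ r₂)ᶜ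
  decay : (fun x => u x - H x) =O[Bornology.cobounded (ES n)] fun x => ‖x‖ ^ (1 - (n : ℝ))
  bdry₁ : ∀ x ∈ sphere c₁ r₁, u x = v₁
  bdry₂ : ∀ x ∈ sphere c₂ r₂, u x = v₂
  flux₁ : flux u c₁ r₁ = 0
  flux₂ : flux u c₂ r₂ = 0

/-- Reflection (inversion) with respect to the sphere of center `c` and radius `r`:
`R(x) = c + r²(x−c)/|x−c|²`. -/
def reflBall {n : ℕ} (c : ES n) (r : ℝ) (x : ES n) : ES n :=
  c + (r ^ 2 / ‖x - c‖ ^ 2) • (x - c)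

/-- The sequence of reflected centers `c_{s,m}`, starting from the center `c₁` of the first
ball: `c_{s,0} = c₁`, `c_{s,2k+1} = R₂(c_{s,2k})`, `c_{s,2k+2} = R₁(c_{s,2k+1})`
(the sequence for `s = 2` is obtained by swapping the roles of the two balls). -/
def cSeq {n : ℕ} (c₁ c₂ : ES n) (r₁ r₂ : ℝ) : ℕ → ES n
  | 0 => c₁
  | m + 1 =>
    if m % 2 = 0 then reflBall c₂ r₂ (cSeq c₁ c₂ r₁ r₂ m)
    else reflBall c₁ r₁ (cSeq c₁ c₂ r₁ r₂ m)

/-- The contraction factors `ρ_{s,j}`: `ρ_{s,0} = 1`,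
`ρ_{s,2k+1} = r₂/|c₂ − c_{s,2k}|`, `ρ_{s,2k+2} = r₁/|c₁ − c_{s,2k+1}|`. -/
def rhoSeq {n : ℕ} (c₁ c₂ : ES n) (r₁ r₂ : ℝ) : ℕ → ℝ
  | 0 => 1
  | m + 1 =>
    if m % 2 = 0 then r₂ / ‖c₂ - cSeq c₁ c₂ r₁ r₂ m‖
    else r₁ / ‖c₁ - cSeq c₁ c₂ r₁ r₂ m‖

/-- `q_{s,m} = ∏_{j=0}^m ρ_{s,j}`. -/
def qSeq {n : ℕ} (c₁ c₂ : ES n) (r₁ r₂ : ℝ) (m : ℕ) : ℝ :=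
  ∏ j ∈ Finset.range (m + 1), rhoSeq c₁ c₂ r₁ r₂ j

/-- `Q_s = Σ_{m=0}^∞ (−1)^m q_{s,m}^{n−2}`. -/
def QSum (n : ℕ) (c₁ c₂ : ES n) (r₁ r₂ : ℝ) : ℝ :=
  ∑' m : ℕ, (-1 : ℝ) ^ m * qSeq c₁ c₂ r₁ r₂ m ^ (n - 2)

/-- `M = Q₂·Σ_k q_{1,2k}^{n−2} + Q₁·Σ_k q_{2,2k+1}^{n−2}`. -/
def MSum (n : ℕ) (c₁ c₂ : ES n) (r₁ r₂ : ℝ) : ℝ :=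
  QSum n c₂ c₁ r₂ r₁ * ∑' k : ℕ, qSeq c₁ c₂ r₁ r₂ (2 * k) ^ (n - 2) +
    QSum n c₁ c₂ r₁ r₂ * ∑' k : ℕ, qSeq c₂ c₁ r₂ r₁ (2 * k + 1) ^ (n - 2)

/-- `ωₙ`: the surface area of the unit sphere in `ℝⁿ`, as the `(n−1)`-dimensional
Hausdorff measure of the unit sphere. -/
def sphereArea (n : ℕ) : ℝ := (μH[(n - 1 : ℝ)] (sphere (0 : ES n) 1)).toReal

/-- The candidate dual function
`h(x) = (1/((2−n)ωₙM))·[Q₂·Σ_m (−1)^m q_{1,m}^{n−2}/|x−c_{1,m}|^{n−2}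
        − Q₁·Σ_m (−1)^m q_{2,m}^{n−2}/|x−c_{2,m}|^{n−2}]`. -/
def hFun (n : ℕ) (c₁ c₂ : ES n) (r₁ r₂ : ℝ) (x : ES n) : ℝ :=
  (1 / ((2 - (n : ℝ)) * sphereArea n * MSum n c₁ c₂ r₁ r₂)) *
    (QSum n c₂ c₁ r₂ r₁ *
        ∑' m : ℕ, (-1 : ℝ) ^ m * qSeq c₁ c₂ r₁ r₂ m ^ (n - 2) /
          ‖x - cSeq c₁ c₂ r₁ r₂ m‖ ^ (n - 2)
      - QSum n c₁ c₂ r₁ r₂ *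
        ∑' m : ℕ, (-1 : ℝ) ^ m * qSeq c₂ c₁ r₂ r₁ m ^ (n - 2) /
          ‖x - cSeq c₂ c₁ r₂ r₁ m‖ ^ (n - 2))

theorem hausdorffMeasure_sphere_lt_top {n : ℕ} (hn : 1 ≤ n) {r : ℝ} (hr : 0 < r) :
    μH[(n - 1 : ℝ)] (sphere (0 : ES n) r) < ⊤ := by
  obtain ⟨m, rfl⟩ : ∃ m, n = m + 1 := ⟨n - 1, by omega⟩
  have hm : ((m + 1 : ℕ) - 1 : ℝ) = m := by push_cast; ring
  rw [hm]
  let L : Fin (m + 1) → ℝ → (Fin m → ℝ) → ES (m + 1) :=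
    fun i σ y => WithLp.toLp 2 (i.insertNth σ y)
  let G : Fin (m + 1) → ℝ → (Fin m → ℝ) → ES (m + 1) :=
    fun i σ y => (r / ‖L i σ y‖) • L i σ y
  have hLd : ∀ i σ, ContDiff ℝ 1 (L i σ) := by
    intro i σ
    rw [contDiff_euclidean]
    intro j
    induction j using i.succAboveCases with
    | x => simpa [L] using contDiff_const
    | p j => simpa [L] using contDiff_apply ℝ ℝ j
  have hL0 : ∀ i σ y, σ ≠ 0 → L i σ y ≠ 0 := by
    intro i σ y hσ h
    apply hσ
    have := congrArg (fun z : ES (m + 1) => z i) h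
    simpa [L] using this
  have hfin : ∀ i σ, σ ≠ 0 → μH[(m : ℝ)] (G i σ '' Set.Icc (-1) 1) < ⊤ := by
    intro i σ hσ
    have hG : ContDiff ℝ 1 (G i σ) := by
      refine ContDiff.smul (contDiff_const.div ((hLd i σ).norm ℝ fun y => hL0 i σ y hσ) ?_)
        (hLd i σ)
      intro y
      exact norm_ne_zero_iff.2 (hL0 i σ y hσ)
    obtain ⟨K, hK⟩ := hG.locallyLipschitz.locallyLipschitzOn.exists_lipschitzOnWith_of_compact
      (isCompact_Icc (a := (-1 : Fin m → ℝ)) (b := 1))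
    refine (hK.hausdorffMeasure_image_le (by positivity)).trans_lt ?_
    have hvol : μH[(m : ℝ)] (Set.Icc (-1 : Fin m → ℝ) 1) < ⊤ := by
      have := hausdorffMeasure_pi_real (ι := Fin m)
      rw [Fintype.card_fin] at this
      rw [this]
      exact isCompact_Icc.measure_lt_top
    exact ENNReal.mul_lt_top (ENNReal.rpow_lt_top_of_nonneg (by positivity) (by simp)) hvol
  have hcov : sphere (0 : ES (m + 1)) r ⊆
      ⋃ i : Fin (m + 1), (G i 1 '' Set.Icc (-1) 1 ∪ G i (-1) '' Set.Icc (-1) 1) := by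
    intro x hx
    rw [mem_sphere_zero_iff_norm] at hx
    obtain ⟨i, -, hi⟩ := Finset.exists_max_image Finset.univ (fun i => |x i|) ⟨0, by simp⟩
    rw [Set.mem_iUnion]
    refine ⟨i, ?_⟩
    have hxi : x i ≠ 0 := by
      intro hxi
      have hx0 : x = 0 := by
        ext j
        simpa [hxi] using hi j (by simp)
      simp [hx0, hr.ne] at hx
    have hxi' : 0 < |x i| := abs_pos.2 hxi
    have key : ∀ σ : ℝ, x i = |x i| * σ → x ∈ G i σ '' Set.Icc (-1) 1 := by
      intro σ hσ
      refine ⟨fun j => x (i.succAbove j) / |x i|, ?_, ?_⟩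
      · have : ∀ j, abs (x (i.succAbove j) / abs (x i)) ≤ 1 := by
          intro j
          rw [abs_div, abs_abs, div_le_one hxi']
          exact hi _ (by simp)
        exact ⟨fun j => (abs_le.1 (this j)).1, fun j => (abs_le.1 (this j)).2⟩
      · have hL : L i σ (fun j => x (i.succAbove j) / |x i|) = |x i|⁻¹ • x := by
          ext j
          induction j using i.succAboveCases with
          | x =>
            simp only [L, Fin.insertNth_apply_same, PiLp.smul_apply, smul_eq_mul]
            rw [eq_inv_mul_iff_mul_eq₀ hxi'.ne', ← hσ]
          | p j => simp [L, div_eq_inv_mul]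
        have hone : r / (|x i|⁻¹ * r) * |x i|⁻¹ = 1 := by
          field_simp
        simp only [G, hL, norm_smul, hx, smul_smul]
        rw [norm_inv, Real.norm_eq_abs, abs_abs, hone, one_smul]
    rcases lt_or_gt_of_ne hxi with h | h
    · right
      exact key _ (by rw [abs_of_neg h]; ring)
    · left
      exact key _ (by rw [abs_of_pos h]; ring)
  refine (measure_mono hcov).trans_lt ((measure_iUnion_fintype_le _ _).trans_lt ?_)
  refine ENNReal.sum_lt_top.2 fun i _ => ?_
  exact (measure_union_le _ _).trans_lt
    (ENNReal.add_lt_top.2 ⟨hfin i 1 (by simp), hfin i (-1) (by simp)⟩)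

theorem hausdorffMeasure_unit_sphere_pos {n : ℕ} (hn : 1 ≤ n) :
    0 < μH[(n - 1 : ℝ)] (sphere (0 : ES n) 1) := by
  obtain ⟨m, rfl⟩ : ∃ m, n = m + 1 := ⟨n - 1, by omega⟩
  have hm : ((m + 1 : ℕ) - 1 : ℝ) = m := by push_cast; ring
  rw [hm]
  let P : ES (m + 1) → (Fin m → ℝ) := fun x j => x j.succ
  have hP : LipschitzWith 1 P := by
    refine LipschitzWith.of_dist_le_mul fun x y => ?_
    rw [NNReal.coe_one, one_mul, dist_pi_le_iff dist_nonneg]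
    intro j
    rw [dist_eq_norm, dist_eq_norm]
    exact PiLp.norm_apply_le (x - y) j.succ
  have hle := hP.hausdorffMeasure_image_le (d := m) (by positivity) (sphere (0 : ES (m + 1)) 1)
  have hsub : {y : Fin m → ℝ | ∑ j, y j ^ 2 < 1} ⊆ P '' sphere (0 : ES (m + 1)) 1 := by
    intro y hy
    rw [Set.mem_ofPred_eq] at hy
    refine ⟨WithLp.toLp 2 (Fin.cons (√(1 - ∑ j, y j ^ 2)) y), ?_, ?_⟩
    · rw [mem_sphere_zero_iff_norm, EuclideanSpace.norm_eq]
      simp [Fin.sum_univ_succ, Real.sq_sqrt (sub_nonneg.2 hy.le)]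
    · ext j
      simp [P]
  have hopen : IsOpen {y : Fin m → ℝ | ∑ j, y j ^ 2 < 1} :=
    isOpen_lt (by fun_prop) continuous_const
  have hvol := hausdorffMeasure_pi_real (ι := Fin m)
  rw [Fintype.card_fin] at hvol
  have hpos : 0 < μH[(m : ℝ)] {y : Fin m → ℝ | ∑ j, y j ^ 2 < 1} := by
    rw [hvol]
    exact hopen.measure_pos _ ⟨0, by simp⟩
  refine (hpos.trans_le ((measure_mono hsub).trans hle)).trans_le ?_
  simp

theorem sphereArea_pos {n : ℕ} (hn : 1 ≤ n) : 0 < sphereArea n :=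
  ENNReal.toReal_pos (hausdorffMeasure_unit_sphere_pos hn).ne'
    (hausdorffMeasure_sphere_lt_top hn one_pos).ne

open scoped Pointwise in
theorem hausdorffMeasure_real_sphere {n : ℕ} (hn : 1 ≤ n) {r : ℝ} (hr : 0 < r) :
    (μH[(n - 1 : ℝ)]).real (sphere (0 : ES n) r) = r ^ (n - 1) * sphereArea n := by
  have h1 : (0 : ℝ) ≤ n - 1 := by
    have : (1 : ℝ) ≤ n := by exact_mod_cast hn
    linarith
  have hs : sphere (0 : ES n) r = r • sphere (0 : ES n) 1 := by
    rw [smul_sphere' hr.ne']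
    simp [abs_of_pos hr]
  rw [hs, Measure.real, Measure.hausdorffMeasure_smul₀ h1 hr.ne', sphereArea]
  have : ‖r‖₊ ^ ((n : ℝ) - 1) = ‖r‖₊ ^ (n - 1) := by
    rw [← NNReal.rpow_natCast, Nat.cast_sub hn, Nat.cast_one]
  rw [this, ENNReal.toReal_smul, NNReal.smul_def]
  simp [abs_of_pos hr]

theorem hasDerivAt_setIntegral_of_isCompact {X : Type*} [TopologicalSpace X] [T2Space X]
    [SecondCountableTopology X] [MeasurableSpace X] [OpensMeasurableSpace X]
    {μ : Measure X} {S : Set X} (hS : IsCompact S) (hμ : μ S < ⊤) {F F' : ℝ → X → ℝ} {a b t₀ : ℝ}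
    (ht₀ : t₀ ∈ Set.Ioo a b) (hF : ∀ t ∈ Set.Icc a b, ContinuousOn (F t) S)
    (hF' : ContinuousOn (fun z : ℝ × X => F' z.1 z.2) (Set.Icc a b ×ˢ S))
    (hd : ∀ t ∈ Set.Icc a b, ∀ x ∈ S, HasDerivAt (fun t => F t x) (F' t x) t) :
    HasDerivAt (fun t => ∫ x in S, F t x ∂μ) (∫ x in S, F' t₀ x ∂μ) t₀ := by
  have hSm : MeasurableSet S := hS.measurableSet
  have : IsFiniteMeasure (μ.restrict S) := ⟨by simpa using hμ⟩
  obtain ⟨C, hC⟩ := (isCompact_Icc.prod hS).exists_bound_of_continuousOn hF'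
  have hmem := Set.Ioo_subset_Icc_self ht₀
  have hF'₀ : ContinuousOn (F' t₀) S :=
    hF'.comp (f := fun x => (t₀, x)) (by fun_prop) fun x hx => ⟨hmem, hx⟩
  refine (hasDerivAt_integral_of_dominated_loc_of_deriv_le (F' := F') (bound := fun _ => C)
    (Icc_mem_nhds ht₀.1 ht₀.2) ?_ ?_ ?_ ?_ (integrable_const C) ?_).2
  · filter_upwards [Icc_mem_nhds ht₀.1 ht₀.2] with t ht
    exact (hF t ht).aestronglyMeasurable hSm
  · exact (hF t₀ hmem).integrableOn_of_subset_isCompact hS hSm subset_rfl hμ.ne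
  · exact hF'₀.aestronglyMeasurable hSm
  · filter_upwards [ae_restrict_mem hSm] with x hx t ht
    exact hC (t, x) ⟨ht, hx⟩
  · filter_upwards [ae_restrict_mem hSm] with x hx t ht
    exact hd t ht x hx

theorem setIntegral_sphere_comp_linearIsometryEquiv {n : ℕ} (d r : ℝ) (U : ES n ≃ₗᵢ[ℝ] ES n)
    (g : ES n → ℝ) :
    ∫ x in sphere (0 : ES n) r, g (U x) ∂μH[d] = ∫ x in sphere (0 : ES n) r, g x ∂μH[d] := by
  have h := (U.toIsometryEquiv.measurePreserving_hausdorffMeasure d).setIntegral_preimage_emb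
    U.toHomeomorph.measurableEmbedding g (sphere (0 : ES n) r)
  have hpre : U.toIsometryEquiv ⁻¹' sphere (0 : ES n) r = sphere 0 r := by
    ext x
    simp
  rw [hpre] at h
  exact h

/-- The reflection exchanging `cos b • eᵢ - sin b • eⱼ` with `eᵢ`. -/
theorem exists_linearIsometryEquiv_rotate_coords {n : ℕ} {i j : Fin n} (hij : i ≠ j) (b : ℝ) :
    ∃ U : ES n ≃ₗᵢ[ℝ] ES n, ∀ x, U x i = x i * Real.cos b - x j * Real.sin b ∧
      U x j = -(x j * Real.cos b + x i * Real.sin b) := by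
  set v : ES n := EuclideanSpace.single j (Real.cos (b / 2)) +
    EuclideanSpace.single i (Real.sin (b / 2)) with hv
  have hvi : v i = Real.sin (b / 2) := by simp [hv, hij]
  have hvj : v j = Real.cos (b / 2) := by simp [hv, hij.symm]
  have hinner : ∀ x : ES n, ⟪v, x⟫ = x j * Real.cos (b / 2) + x i * Real.sin (b / 2) := by
    intro x
    rw [hv, inner_add_left, EuclideanSpace.inner_single_left, EuclideanSpace.inner_single_left]
    simp [mul_comm]
  have hnorm : ‖v‖ ^ 2 = 1 := by
    rw [← real_inner_self_eq_norm_sq, hinner, hvi, hvj]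
    nlinarith [Real.sin_sq_add_cos_sq (b / 2)]
  have hcos : Real.cos b = 2 * Real.cos (b / 2) ^ 2 - 1 := by
    rw [← Real.cos_two_mul]; ring_nf
  have hsin : Real.sin b = 2 * Real.sin (b / 2) * Real.cos (b / 2) := by
    rw [← Real.sin_two_mul]; ring_nf
  have hsq := Real.sin_sq_add_cos_sq (b / 2)
  refine ⟨(ℝ ∙ v)ᗮ.reflection, fun x => ?_⟩
  rw [Submodule.reflection_orthogonal_apply, Submodule.reflection_singleton_apply]
  simp only [RCLike.ofReal_real_eq_id, id_eq, hnorm, div_one, hinner, PiLp.neg_apply,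
    PiLp.sub_apply, PiLp.smul_apply, smul_eq_mul, nsmul_eq_mul, hvi, hvj, hcos, hsin]
  constructor
  · push_cast
    linear_combination (-2 * x i) * hsq
  · push_cast
    ring

theorem mem_Icc_of_mem_sphere {n : ℕ} {r : ℝ} {x : ES n} (hx : x ∈ sphere (0 : ES n) r)
    (i : Fin n) : x i ∈ Set.Icc (-r) r := by
  rw [mem_sphere_zero_iff_norm] at hx
  have := PiLp.norm_apply_le x i
  rw [hx] at this
  exact abs_le.1 this

theorem integrableOn_sphere {n : ℕ} (hn : 1 ≤ n) {r : ℝ} (hr : 0 < r) {g : ES n → ℝ}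
    (hg : ContinuousOn g (sphere 0 r)) : IntegrableOn g (sphere 0 r) μH[(n - 1 : ℝ)] :=
  hg.integrableOn_of_subset_isCompact (isCompact_sphere 0 r) isClosed_sphere.measurableSet
    subset_rfl (hausdorffMeasure_sphere_lt_top hn hr).ne

theorem setIntegral_sphere_coord_mul {n : ℕ} (hn : 1 ≤ n) {r : ℝ} (hr : 0 < r)
    {i j : Fin n} (hij : i ≠ j) {ψ ψ' : ℝ → ℝ}
    (hψ : ∀ s ∈ Set.Icc (-r) r, HasDerivAt ψ (ψ' s) s) (hψ' : ContinuousOn ψ' (Set.Icc (-r) r)) :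
    ∫ x in sphere (0 : ES n) r, x i * ψ (x i) ∂μH[(n - 1 : ℝ)] =
      ∫ x in sphere (0 : ES n) r, x j ^ 2 * ψ' (x i) ∂μH[(n - 1 : ℝ)] := by
  set S := sphere (0 : ES n) r
  have hψc : ContinuousOn ψ (Set.Icc (-r) r) := fun s hs => (hψ s hs).continuousAt.continuousWithinAt
  let X : ℝ → ES n → ℝ := fun b x => x i * Real.cos b - x j * Real.sin b
  let Y : ℝ → ES n → ℝ := fun b x => -(x j * Real.cos b + x i * Real.sin b)
  have hX : Continuous fun z : ℝ × ES n => X z.1 z.2 := by fun_prop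
  have hY : Continuous fun z : ℝ × ES n => Y z.1 z.2 := by fun_prop
  have hXmem : ∀ b, ∀ x ∈ S, X b x ∈ Set.Icc (-r) r := by
    intro b x hx
    obtain ⟨U, hU⟩ := exists_linearIsometryEquiv_rotate_coords hij b
    have hUx : U x ∈ S := by simpa [S] using hx
    have := mem_Icc_of_mem_sphere hUx i
    rwa [(hU x).1] at this
  have hconst : ∀ b, ∫ x in S, Y b x * ψ (X b x) ∂μH[(n - 1 : ℝ)] =
      ∫ x in S, x j * ψ (x i) ∂μH[(n - 1 : ℝ)] := by
    intro b
    obtain ⟨U, hU⟩ := exists_linearIsometryEquiv_rotate_coords hij b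
    rw [← setIntegral_sphere_comp_linearIsometryEquiv _ r U (fun x => x j * ψ (x i))]
    simp only [(hU _).1, (hU _).2, X, Y, S]
  have hder := hasDerivAt_setIntegral_of_isCompact (isCompact_sphere (0 : ES n) r)
    (hausdorffMeasure_sphere_lt_top hn hr) (a := -1) (b := 1) (t₀ := 0)
    (F := fun b x => Y b x * ψ (X b x))
    (F' := fun b x => -(X b x * ψ (X b x)) + Y b x ^ 2 * ψ' (X b x))
    (by simp) ?_ ?_ ?_
  · simp only [S] at hconst
    simp only [hconst] at hder
    have h0 := hder.unique (hasDerivAt_const _ _)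
    simp only [X, Y, Real.cos_zero, Real.sin_zero, mul_one, mul_zero, sub_zero, add_zero,
      neg_sq] at h0
    have hci : ContinuousOn (fun x : ES n => x i) S := by fun_prop
    have hcj : ContinuousOn (fun x : ES n => x j) S := by fun_prop
    have hm : Set.MapsTo (fun x : ES n => x i) S (Set.Icc (-r) r) :=
      fun x hx => mem_Icc_of_mem_sphere hx i
    rw [integral_add, integral_neg] at h0
    · linarith
    · exact (integrableOn_sphere hn hr (hci.mul (hψc.comp hci hm))).neg
    · exact integrableOn_sphere hn hr ((hcj.pow 2).mul (hψ'.comp hci hm))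
  · intro b _
    have hXb : Continuous (X b) := by fun_prop
    have hYb : Continuous (Y b) := by fun_prop
    exact hYb.continuousOn.mul (hψc.comp hXb.continuousOn (hXmem b))
  · have hm : Set.MapsTo (fun z : ℝ × ES n => X z.1 z.2) (Set.Icc (-1) 1 ×ˢ S)
        (Set.Icc (-r) r) := fun z hz => hXmem _ _ hz.2
    exact ((hX.continuousOn.mul (hψc.comp hX.continuousOn hm)).neg).add
      ((hY.continuousOn.pow 2).mul (hψ'.comp hX.continuousOn hm))
  · intro b _ x hx
    have h1 : HasDerivAt (fun b => X b x) (Y b x) b := by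
      refine (((Real.hasDerivAt_cos b).const_mul (x i)).sub
        ((Real.hasDerivAt_sin b).const_mul (x j))).congr_deriv ?_
      simp only [Y]; ring
    have h2 : HasDerivAt (fun b => Y b x) (-X b x) b := by
      refine (((Real.hasDerivAt_cos b).const_mul (x j)).add
        ((Real.hasDerivAt_sin b).const_mul (x i))).neg.congr_deriv ?_
      simp only [X]; ring
    refine (h2.mul ((hψ _ (hXmem b x hx)).comp b h1)).congr_deriv ?_
    simp only [Function.comp_apply]
    ring

/-- Integration by parts on the sphere for functions of a single coordinate. -/
theorem setIntegral_sphere_by_parts {n : ℕ} (hn : 1 ≤ n) {r : ℝ} (hr : 0 < r)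
    (i : Fin n) {ψ ψ' : ℝ → ℝ}
    (hψ : ∀ s ∈ Set.Icc (-r) r, HasDerivAt ψ (ψ' s) s) (hψ' : ContinuousOn ψ' (Set.Icc (-r) r)) :
    ∫ x in sphere (0 : ES n) r, ((r ^ 2 - x i ^ 2) * ψ' (x i) - (n - 1) * (x i * ψ (x i)))
      ∂μH[(n - 1 : ℝ)] = 0 := by
  have hψc : ContinuousOn ψ (Set.Icc (-r) r) := fun s hs => (hψ s hs).continuousAt.continuousWithinAt
  have hci : ContinuousOn (fun x : ES n => x i) (sphere 0 r) := by fun_prop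
  have hm : Set.MapsTo (fun x : ES n => x i) (sphere 0 r) (Set.Icc (-r) r) :=
    fun x hx => mem_Icc_of_mem_sphere hx i
  have hsum : ∀ x ∈ sphere (0 : ES n) r,
      (r ^ 2 - x i ^ 2) * ψ' (x i) - (n - 1) * (x i * ψ (x i)) =
        ∑ j ∈ Finset.univ.erase i, (x j ^ 2 * ψ' (x i) - x i * ψ (x i)) := by
    intro x hx
    rw [mem_sphere_zero_iff_norm] at hx
    have h2 : r ^ 2 - x i ^ 2 = ∑ j ∈ Finset.univ.erase i, x j ^ 2 := by
      rw [← hx, EuclideanSpace.real_norm_sq_eq,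
        ← Finset.add_sum_erase _ _ (Finset.mem_univ i)]
      ring
    rw [h2, Finset.sum_sub_distrib, Finset.sum_const, Finset.card_erase_of_mem (Finset.mem_univ i),
      Finset.sum_mul, Finset.card_univ, Fintype.card_fin, nsmul_eq_mul, Nat.cast_sub hn,
      Nat.cast_one]
  rw [setIntegral_congr_fun isClosed_sphere.measurableSet hsum]
  have hint : ∀ j, IntegrableOn (fun x : ES n => x j ^ 2 * ψ' (x i)) (sphere 0 r)
      μH[(n - 1 : ℝ)] := fun j =>
    integrableOn_sphere hn hr ((ContinuousOn.pow (by fun_prop) 2).mul (hψ'.comp hci hm))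
  have hint' : IntegrableOn (fun x : ES n => x i * ψ (x i)) (sphere 0 r) μH[(n - 1 : ℝ)] :=
    integrableOn_sphere hn hr (hci.mul (hψc.comp hci hm))
  rw [integral_finsetSum]
  swap
  · exact fun j _ => (hint j).sub hint'
  refine Finset.sum_eq_zero fun j hj => ?_
  rw [integral_sub (hint j) hint',
    setIntegral_sphere_coord_mul hn hr (Finset.ne_of_mem_erase hj).symm hψ hψ', sub_self]

theorem sq_dist_axis_pos {r s t : ℝ} (hs : s ∈ Set.Icc (-r) r) (ht : |t| ≠ r) :
    0 < r ^ 2 - 2 * t * s + t ^ 2 := by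
  rcases (sq_nonneg (t - s)).eq_or_lt with h | h
  · have hts : t = s := by nlinarith
    have hsr : |s| < r := lt_of_le_of_ne (abs_le.2 hs) (hts ▸ ht)
    have := (sq_lt_sq₀ (abs_nonneg s) ((abs_nonneg s).trans hsr.le)).2 hsr
    rw [sq_abs] at this
    subst hts
    nlinarith
  · have : s ^ 2 ≤ r ^ 2 := sq_le_sq' hs.1 hs.2
    nlinarith

/-- The flux density at `x ∈ ∂B_r(0)`, up to a constant, of the potential of a unit charge at
the point `t` of the `i`-th axis, as a function of `s = x i`. -/
def axisKernel (n : ℕ) (r t s : ℝ) : ℝ :=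
  (r ^ 2 - t * s) * (r ^ 2 - 2 * t * s + t ^ 2) ^ (-(n : ℝ) / 2)

theorem continuousOn_axisKernel (n : ℕ) {r t : ℝ} (ht : |t| ≠ r) :
    ContinuousOn (axisKernel n r t) (Set.Icc (-r) r) := by
  refine ContinuousOn.mul (by fun_prop) (ContinuousOn.rpow_const (by fun_prop) fun s hs => ?_)
  exact Or.inl (sq_dist_axis_pos hs ht).ne'

theorem hasDerivAt_integral_axisKernel {n : ℕ} (hn : 1 ≤ n) {r t : ℝ} (hr : 0 < r) (i : Fin n)
    (ht : |t| ≠ r) :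
    HasDerivAt (fun t => ∫ x in sphere (0 : ES n) r, axisKernel n r t (x i) ∂μH[(n - 1 : ℝ)])
      0 t := by
  obtain ⟨δ, hδ, hball⟩ := Metric.isOpen_iff.1
    (isOpen_ne_fun (continuous_abs (G := ℝ)) (continuous_const (y := r))) t ht
  have hab : ∀ t' ∈ Set.Icc (t - δ / 2) (t + δ / 2), |t'| ≠ r := by
    intro t' ht'
    refine hball ?_
    rw [mem_ball, Real.dist_eq, abs_lt]
    constructor <;> linarith [ht'.1, ht'.2]
  let D : ℝ → ℝ → ℝ := fun t s => r ^ 2 - 2 * t * s + t ^ 2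
  let K' : ℝ → ℝ → ℝ := fun t s => -s * D t s ^ (-(n : ℝ) / 2) -
    n * ((r ^ 2 - t * s) * (t - s)) * D t s ^ (-(n : ℝ) / 2 - 1)
  have hmem : ∀ x ∈ sphere (0 : ES n) r, x i ∈ Set.Icc (-r) r :=
    fun x hx => mem_Icc_of_mem_sphere hx i
  have hder := hasDerivAt_setIntegral_of_isCompact (isCompact_sphere (0 : ES n) r)
    (hausdorffMeasure_sphere_lt_top hn hr) (a := t - δ / 2) (b := t + δ / 2) (t₀ := t)
    (F := fun t x => axisKernel n r t (x i)) (F' := fun t x => K' t (x i))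
    ⟨by linarith, by linarith⟩ ?_ ?_ ?_
  · convert! hder using 1
    have hparts := setIntegral_sphere_by_parts hn hr i
      (ψ := fun s => D t s ^ (-(n : ℝ) / 2))
      (ψ' := fun s => n * t * D t s ^ (-(n : ℝ) / 2 - 1)) ?_ ?_
    · rw [← neg_zero, ← hparts, ← integral_neg]
      refine setIntegral_congr_fun isClosed_sphere.measurableSet fun x hx => ?_
      have hD : 0 < D t (x i) := sq_dist_axis_pos (hmem x hx) ht
      have hpow : D t (x i) ^ (-(n : ℝ) / 2) =
          D t (x i) * D t (x i) ^ (-(n : ℝ) / 2 - 1) := by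
        rw [Real.rpow_sub_one hD.ne']
        field_simp
      simp only [K', hpow]
      simp only [D]
      ring
    · intro s hs
      have hD : 0 < D t s := sq_dist_axis_pos hs ht
      have h1 : HasDerivAt (fun s => D t s) (-(2 * t)) s := by
        refine ((((hasDerivAt_id s).const_mul (2 * t)).const_sub (r ^ 2)).add_const
          (t ^ 2)).congr_deriv ?_
        simp
      refine (h1.rpow_const (p := -(n : ℝ) / 2) (Or.inl hD.ne')).congr_deriv ?_
      ring
    · refine ContinuousOn.mul (by fun_prop) (ContinuousOn.rpow_const (by fun_prop) fun s hs => ?_)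
      exact Or.inl (sq_dist_axis_pos hs ht).ne'
  · intro t' ht'
    exact (continuousOn_axisKernel n (hab t' ht')).comp (by fun_prop) hmem
  · have hD : ContinuousOn (fun z : ℝ × ES n => D z.1 (z.2 i))
        (Set.Icc (t - δ / 2) (t + δ / 2) ×ˢ sphere (0 : ES n) r) := by fun_prop
    have hD0 : ∀ z ∈ Set.Icc (t - δ / 2) (t + δ / 2) ×ˢ sphere (0 : ES n) r,
        D z.1 (z.2 i) ≠ 0 := fun z hz => (sq_dist_axis_pos (hmem _ hz.2) (hab _ hz.1)).ne'
    exact (ContinuousOn.mul (by fun_prop) (hD.rpow_const fun z hz => Or.inl (hD0 z hz))).sub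
      (ContinuousOn.mul (by fun_prop) (hD.rpow_const fun z hz => Or.inl (hD0 z hz)))
  · intro t' ht' x hx
    have hD : 0 < D t' (x i) := sq_dist_axis_pos (hmem x hx) (hab t' ht')
    have h1 : HasDerivAt (fun t => D t (x i)) (-2 * x i + 2 * t') t' := by
      refine (((((hasDerivAt_id t').const_mul 2).mul_const (x i)).const_sub (r ^ 2)).add
        (hasDerivAt_pow 2 t')).congr_deriv ?_
      simp
    have h2 : HasDerivAt (fun t => r ^ 2 - t * x i) (-x i) t' := by
      refine (((hasDerivAt_id t').mul_const (x i)).const_sub (r ^ 2)).congr_deriv ?_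
      simp
    refine (h2.mul (h1.rpow_const (p := -(n : ℝ) / 2) (Or.inl hD.ne'))).congr_deriv ?_
    simp only [K']
    ring

theorem sq_rpow_neg_half (n : ℕ) {x : ℝ} (hx : 0 ≤ x) :
    (x ^ 2) ^ (-(n : ℝ) / 2) = (x ^ n)⁻¹ := by
  rw [← Real.rpow_natCast x 2, ← Real.rpow_mul hx, ← Real.rpow_natCast x n, ← Real.rpow_neg hx]
  congr 1
  push_cast
  ring

theorem integral_axisKernel_of_lt {n : ℕ} (hn : 2 ≤ n) {r t : ℝ} (hr : 0 < r) (i : Fin n)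
    (ht0 : 0 ≤ t) (ht : t < r) :
    ∫ x in sphere (0 : ES n) r, axisKernel n r t (x i) ∂μH[(n - 1 : ℝ)] = r * sphereArea n := by
  have hn1 : 1 ≤ n := by omega
  have hder : ∀ t ∈ Set.Ioo (-r) r, HasDerivAt (fun t => ∫ x in sphere (0 : ES n) r,
      axisKernel n r t (x i) ∂μH[(n - 1 : ℝ)]) 0 t := fun t ht =>
    hasDerivAt_integral_axisKernel hn1 hr i (abs_lt.2 ht).ne
  have hconst := (isOpen_Ioo (a := -r) (b := r)).is_const_of_deriv_eq_zero isPreconnected_Ioo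
    (fun t ht => (hder t ht).differentiableAt.differentiableWithinAt)
    (fun t ht => (hder t ht).deriv) (show t ∈ Set.Ioo (-r) r from ⟨by linarith, ht⟩)
    (show (0 : ℝ) ∈ Set.Ioo (-r) r from ⟨by linarith, hr⟩)
  rw [hconst]
  simp only [axisKernel, zero_mul, mul_zero, sub_zero, ne_eq, OfNat.ofNat_ne_zero,
    not_false_eq_true, zero_pow, add_zero]
  rw [setIntegral_const, hausdorffMeasure_real_sphere hn1 hr, sq_rpow_neg_half n hr.le, smul_eq_mul]
  obtain ⟨m, rfl⟩ : ∃ m, n = m + 2 := ⟨n - 2, by omega⟩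
  rw [show m + 2 - 1 = m + 1 by omega]
  field_simp
  ring

theorem integral_axisKernel_of_gt {n : ℕ} (hn : 2 ≤ n) {r t : ℝ} (hr : 0 < r) (i : Fin n)
    (ht : r < t) :
    ∫ x in sphere (0 : ES n) r, axisKernel n r t (x i) ∂μH[(n - 1 : ℝ)] = 0 := by
  have hn1 : 1 ≤ n := by omega
  set I : ℝ → ℝ := fun t => ∫ x in sphere (0 : ES n) r, axisKernel n r t (x i) ∂μH[(n - 1 : ℝ)]
    with hI
  have hder : ∀ t ∈ Set.Ioi r, HasDerivAt I 0 t := fun t ht =>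
    hasDerivAt_integral_axisKernel hn1 hr i (by
      rw [abs_of_pos (hr.trans ht)]
      exact ht.ne')
  have hconst : ∀ t' ∈ Set.Ioi r, I t' = I t := fun t' ht' =>
    isOpen_Ioi.is_const_of_deriv_eq_zero isPreconnected_Ioi
    (fun t ht => (hder t ht).differentiableAt.differentiableWithinAt)
    (fun t ht => (hder t ht).deriv) ht' ht
  set A := (μH[(n - 1 : ℝ)]).real (sphere (0 : ES n) r)
  have hbound : ∀ t' ≥ 2 * r + 2, |I t'| ≤ 8 * r * A / t' := by
    intro t' ht'
    have hpos : 0 < t' := by linarith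
    have hb : ∀ x ∈ sphere (0 : ES n) r, ‖axisKernel n r t' (x i)‖ ≤ 8 * r / t' := by
      intro x hx
      obtain ⟨hx1, hx2⟩ := mem_Icc_of_mem_sphere hx i
      have h1 : |r ^ 2 - t' * x i| ≤ 2 * t' * r := by
        rw [abs_le]
        constructor <;> nlinarith
      have h2 : (t' / 2) ^ 2 ≤ r ^ 2 - 2 * t' * x i + t' ^ 2 := by nlinarith
      have h3 : (1 : ℝ) ≤ r ^ 2 - 2 * t' * x i + t' ^ 2 := by nlinarith
      have h4 : (r ^ 2 - 2 * t' * x i + t' ^ 2) ^ (-(n : ℝ) / 2) ≤ 4 / t' ^ 2 := by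
        calc (r ^ 2 - 2 * t' * x i + t' ^ 2) ^ (-(n : ℝ) / 2)
            ≤ (r ^ 2 - 2 * t' * x i + t' ^ 2) ^ (-1 : ℝ) := by
              refine Real.rpow_le_rpow_of_exponent_le h3 ?_
              have : (2 : ℝ) ≤ n := by exact_mod_cast hn
              linarith
          _ = (r ^ 2 - 2 * t' * x i + t' ^ 2)⁻¹ := Real.rpow_neg_one _
          _ ≤ ((t' / 2) ^ 2)⁻¹ := inv_anti₀ (by positivity) h2
          _ = 4 / t' ^ 2 := by field_simp; norm_num
      rw [axisKernel, norm_mul, Real.norm_eq_abs, Real.norm_eq_abs,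
        abs_of_nonneg (Real.rpow_nonneg (by linarith) _)]
      calc _ ≤ (2 * t' * r) * (4 / t' ^ 2) := by
            refine mul_le_mul h1 h4 (Real.rpow_nonneg (by linarith) _) (by positivity)
        _ = 8 * r / t' := by field_simp; norm_num
    have := norm_setIntegral_le_of_norm_le_const (hausdorffMeasure_sphere_lt_top hn1 hr) hb
    calc |I t'| ≤ 8 * r / t' * A := this
      _ = 8 * r * A / t' := by ring
  have hlim : Tendsto (fun t' : ℝ => 8 * r * A / t') atTop (𝓝 0) :=
    tendsto_const_nhds.div_atTop tendsto_id
  have hle : |I t| ≤ 0 := by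
    refine ge_of_tendsto hlim ?_
    filter_upwards [eventually_ge_atTop (2 * r + 2)] with t' ht'
    rw [← hconst t' (show r < t' by linarith)]
    exact hbound t' ht'
  exact abs_nonpos_iff.1 hle

/-- Gauss' law for a unit point charge `p` and a sphere of radius `r`, up to normalization. -/
theorem integral_sphere_flux_kernel {n : ℕ} (hn : 2 ≤ n) {r : ℝ} (hr : 0 < r) (p : ES n)
    (hp : ‖p‖ ≠ r) :
    ∫ x in sphere (0 : ES n) r, (‖x - p‖ ^ n)⁻¹ * ⟪x - p, x⟫ ∂μH[(n - 1 : ℝ)] =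
      if ‖p‖ < r then r * sphereArea n else 0 := by
  let i : Fin n := ⟨0, by omega⟩
  set e : ES n := EuclideanSpace.single i ‖p‖ with he
  let U : ES n ≃ₗᵢ[ℝ] ES n := (ℝ ∙ (e - p))ᗮ.reflection
  have hU : U e = p := Submodule.reflection_sub (by simp [he])
  rw [← setIntegral_sphere_comp_linearIsometryEquiv _ r U
    (fun x => (‖x - p‖ ^ n)⁻¹ * ⟪x - p, x⟫)]
  have hcongr : ∀ x ∈ sphere (0 : ES n) r, (‖U x - p‖ ^ n)⁻¹ * ⟪U x - p, U x⟫ =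
      axisKernel n r ‖p‖ (x i) := by
    intro x hx
    rw [mem_sphere_zero_iff_norm] at hx
    rw [← hU, ← map_sub, LinearIsometryEquiv.norm_map, LinearIsometryEquiv.inner_map_map, hU]
    have h1 : ⟪e, x⟫ = ‖p‖ * x i := by
      rw [he, EuclideanSpace.inner_single_left]; simp
    have h2 : ⟪x - e, x⟫ = r ^ 2 - ‖p‖ * x i := by
      rw [inner_sub_left, real_inner_self_eq_norm_sq, hx, h1]
    have h3 : ‖x - e‖ ^ 2 = r ^ 2 - 2 * ‖p‖ * x i + ‖p‖ ^ 2 := by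
      have hen : ‖e‖ = ‖p‖ := by simp [he]
      rw [norm_sub_sq_real, hx, real_inner_comm, h1, hen]
      ring
    rw [axisKernel, ← h3, sq_rpow_neg_half n (norm_nonneg _), h2, mul_comm]
  rw [setIntegral_congr_fun isClosed_sphere.measurableSet hcongr]
  split_ifs with h
  · exact integral_axisKernel_of_lt hn hr i (norm_nonneg p) h
  · exact integral_axisKernel_of_gt hn hr i (lt_of_le_of_ne (not_lt.1 h) hp.symm)

/-- A function continuous off the origin is bounded on the differences of the points of two disjoint
compact sets. -/
theorem exists_bound_comp_sub {E F : Type} [NormedAddCommGroup E] [NormedAddCommGroup F] {K : Set E}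
    {φ : E → F} (hφ : ContinuousOn φ {0}ᶜ)
    (hK : IsCompact K) {S : Set E} (hS : IsCompact S) (hSK : Disjoint S K) :
    ∃ C, ∀ y ∈ S, ∀ z ∈ K, ‖φ (y - z)‖ ≤ C := by
  have hmaps : Set.MapsTo (fun w : E × E => w.1 - w.2) (S ×ˢ K) {0}ᶜ := by
    rintro ⟨y, z⟩ ⟨hy, hz⟩ h
    rw [Set.mem_singleton_iff, sub_eq_zero] at h
    exact Set.disjoint_left.1 hSK hy (h ▸ hz)
  obtain ⟨C, hC⟩ := (hS.prod hK).exists_bound_of_continuousOn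
    (hφ.comp (f := fun w : E × E => w.1 - w.2) (by fun_prop) hmaps)
  exact ⟨C, fun y hy z hz => hC (y, z) ⟨hy, hz⟩⟩

theorem summable_smul_translate {E F ι : Type} [NormedAddCommGroup E] [NormedAddCommGroup F]
    [NormedSpace ℝ F] [CompleteSpace F] {a : ι → ℝ} {p : ι → E} {K : Set E} {x : E} {φ : E → F}
    (hφ : ContinuousOn φ {0}ᶜ) (ha : Summable fun i => |a i|) (hK : IsCompact K)
    (hp : ∀ i, p i ∈ K) (hx : x ∉ K) : Summable fun i => a i • φ (x - p i) := by
  obtain ⟨C, hC⟩ := exists_bound_comp_sub hφ hK (isCompact_singleton (x := x))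
    (Set.disjoint_singleton_left.2 hx)
  refine Summable.of_norm_bounded (ha.mul_right C) fun i => ?_
  rw [norm_smul]
  exact mul_le_mul_of_nonneg_left (hC x rfl _ (hp i)) (norm_nonneg _)

section ChargeSeries

variable {E : Type} [NormedAddCommGroup E] [NormedSpace ℝ E]
  {F : Type} [NormedAddCommGroup F] [NormedSpace ℝ F]
  {ι : Type} {a : ι → ℝ} {p : ι → E} {K : Set E} {x : E}

theorem hasFDerivAt_tsum_smul_translate [ProperSpace E] [CompleteSpace F] {φ : E → F}
    (hφ : ContDiffOn ℝ 1 φ {0}ᶜ) (ha : Summable fun i => |a i|) (hK : IsCompact K)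
    (hp : ∀ i, p i ∈ K) (hx : x ∉ K) :
    HasFDerivAt (fun y => ∑' i, a i • φ (y - p i)) (∑' i, a i • fderiv ℝ φ (x - p i)) x := by
  obtain ⟨δ, hδ, hball⟩ := Metric.isOpen_iff.1 hK.isClosed.isOpen_compl x hx
  have hsub : closedBall x (δ / 2) ⊆ Kᶜ := (closedBall_subset_ball (by linarith)).trans hball
  have hfc : ContinuousOn (fderiv ℝ φ) {0}ᶜ :=
    hφ.continuousOn_fderiv_of_isOpen isOpen_compl_singleton le_rfl
  obtain ⟨C, hC⟩ := exists_bound_comp_sub hfc hK (isCompact_closedBall x (δ / 2))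
    (Set.disjoint_left.2 hsub)
  refine hasFDerivAt_tsum_of_isPreconnected (f := fun i y => a i • φ (y - p i))
    (f' := fun i y => a i • fderiv ℝ φ (y - p i)) (ha.mul_right C) isOpen_ball
    (convex_ball x (δ / 2)).isPreconnected ?_ ?_ (mem_ball_self (by linarith))
    (summable_smul_translate hφ.continuousOn ha hK hp hx) (mem_ball_self (by linarith))
  · intro i y hy
    have hne : y - p i ∈ ({0}ᶜ : Set E) := by
      intro h
      rw [Set.mem_singleton_iff, sub_eq_zero] at h
      exact hsub (ball_subset_closedBall hy) (h ▸ hp i)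
    have hd : DifferentiableAt ℝ φ (y - p i) :=
      (hφ.differentiableOn one_ne_zero).differentiableAt
        (isOpen_compl_singleton.mem_nhds hne)
    exact (hd.hasFDerivAt.comp y ((hasFDerivAt_id y).sub_const (p i))).const_smul (a i)
  · intro i y hy
    rw [norm_smul]
    exact mul_le_mul_of_nonneg_left (hC y (ball_subset_closedBall hy) _ (hp i)) (norm_nonneg _)

theorem hasSum_fderiv_smul_translate_apply [ProperSpace E] [CompleteSpace F] {φ : E → F}
    (hφ : ContDiffOn ℝ 1 φ {0}ᶜ) (ha : Summable fun i => |a i|) (hK : IsCompact K)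
    (hp : ∀ i, p i ∈ K) (hx : x ∉ K) (v : E) :
    HasSum (fun i => a i • fderiv ℝ φ (x - p i) v)
      (fderiv ℝ (fun y => ∑' i, a i • φ (y - p i)) x v) := by
  have hfc : ContinuousOn (fderiv ℝ φ) {0}ᶜ :=
    hφ.continuousOn_fderiv_of_isOpen isOpen_compl_singleton le_rfl
  rw [(hasFDerivAt_tsum_smul_translate hφ ha hK hp hx).fderiv]
  exact (summable_smul_translate hfc ha hK hp hx).hasSum.mapL (ContinuousLinearMap.apply ℝ F v)

theorem contDiffOn_tsum_smul_translate [ProperSpace E] [CompleteSpace F] {φ : E → F} (k : ℕ)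
    (hφ : ContDiffOn ℝ (k + 1 : ℕ) φ {0}ᶜ) (ha : Summable fun i => |a i|) (hK : IsCompact K)
    (hp : ∀ i, p i ∈ K) : ContDiffOn ℝ k (fun y => ∑' i, a i • φ (y - p i)) Kᶜ := by
  induction k generalizing F with
  | zero =>
    rw [Nat.cast_zero, contDiffOn_zero]
    intro x hx
    refine (hasFDerivAt_tsum_smul_translate ?_ ha hK hp hx).continuousAt.continuousWithinAt
    exact_mod_cast hφ
  | succ k ih =>
    have hφ1 : ContDiffOn ℝ 1 φ {0}ᶜ := hφ.of_le (by exact_mod_cast Nat.le_add_left 1 (k + 1))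
    have hder := fun x hx => hasFDerivAt_tsum_smul_translate hφ1 ha hK hp (x := x) hx
    push_cast
    rw [contDiffOn_succ_iff_fderiv_of_isOpen hK.isClosed.isOpen_compl]
    refine ⟨fun x hx => (hder x hx).differentiableAt.differentiableWithinAt, by simp, ?_⟩
    refine (ih (φ := fderiv ℝ φ) ?_).congr fun x hx => (hder x hx).fderiv
    exact hφ.fderiv_of_isOpen isOpen_compl_singleton (by norm_cast)

end ChargeSeries

/-- The potential `|x|^{2-n}` of a unit point charge at the origin. -/
def pointPotential (n : ℕ) (x : ES n) : ℝ := (‖x‖ ^ (n - 2))⁻¹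

theorem contDiffOn_pointPotential (n : ℕ) (k : ℕ) :
    ContDiffOn ℝ k (pointPotential n) {0}ᶜ := by
  have h : ContDiffOn ℝ k (fun x : ES n => ‖x‖) {0}ᶜ := fun x hx =>
    (contDiffAt_norm ℝ hx).contDiffWithinAt
  exact (h.pow (n - 2)).inv fun x hx => pow_ne_zero _ (norm_ne_zero_iff.2 hx)

theorem hasFDerivAt_inv_norm_pow {n : ℕ} (k : ℕ) {x : ES n} (hx : x ≠ 0) :
    HasFDerivAt (fun y : ES n => (‖y‖ ^ k)⁻¹) ((-(k : ℝ) * (‖x‖ ^ (k + 2))⁻¹) • innerSL ℝ x) x := by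
  have hx0 : 0 < ‖x‖ := norm_pos_iff.2 hx
  have h1 : HasFDerivAt (fun y : ES n => ‖y‖ ^ 2) (2 • innerSL ℝ x) x :=
    (hasStrictFDerivAt_norm_sq x).hasFDerivAt
  have h2 := h1.rpow_const (p := -(k : ℝ) / 2) (Or.inl (pow_pos hx0 2).ne')
  have hfun : (fun y : ES n => (‖y‖ ^ 2) ^ (-(k : ℝ) / 2)) = fun y => (‖y‖ ^ k)⁻¹ := by
    ext y
    exact sq_rpow_neg_half k (norm_nonneg y)
  rw [hfun] at h2
  refine h2.congr_fderiv ?_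
  have h3 : (‖x‖ ^ 2) ^ (-(k : ℝ) / 2 - 1) = (‖x‖ ^ (k + 2))⁻¹ := by
    rw [← sq_rpow_neg_half _ hx0.le]
    congr 1
    push_cast
    ring
  rw [h3]
  ext v
  simp
  ring

theorem fderiv_pointPotential {n : ℕ} (hn : 2 ≤ n) {x : ES n} (hx : x ≠ 0) (v : ES n) :
    fderiv ℝ (pointPotential n) x v = (2 - n) * ((‖x‖ ^ n)⁻¹ * ⟪x, v⟫) := by
  have h := hasFDerivAt_inv_norm_pow (n - 2) hx
  rw [show n - 2 + 2 = n by omega, Nat.cast_sub hn] at h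
  have h' : fderiv ℝ (pointPotential n) x = _ := h.fderiv
  rw [h']
  simp
  ring

theorem lap_pointPotential {n : ℕ} (hn : 2 ≤ n) {x : ES n} (hx : x ≠ 0) :
    lap (pointPotential n) x = 0 := by
  have hx0 : 0 < ‖x‖ := norm_pos_iff.2 hx
  have hterm : ∀ i : Fin n, fderiv ℝ (fun y => fderiv ℝ (pointPotential n) y
      (EuclideanSpace.single i 1)) x (EuclideanSpace.single i 1) =
      (2 - n) * ((‖x‖ ^ n)⁻¹ - n * (‖x‖ ^ (n + 2))⁻¹ * x i ^ 2) := by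
    intro i
    have heq : (fun y => fderiv ℝ (pointPotential n) y (EuclideanSpace.single i 1)) =ᶠ[𝓝 x]
        fun y => (2 - n) * ((‖y‖ ^ n)⁻¹ * y i) := by
      filter_upwards [isOpen_ne.mem_nhds hx] with y hy
      rw [fderiv_pointPotential hn hy, EuclideanSpace.inner_single_right]
      simp
    rw [heq.fderiv_eq]
    have h1 : HasFDerivAt (fun y : ES n => y i) (EuclideanSpace.proj i : ES n →L[ℝ] ℝ) x :=
      (EuclideanSpace.proj i : ES n →L[ℝ] ℝ).hasFDerivAt
    have h2 := ((hasFDerivAt_inv_norm_pow n hx).mul h1).const_mul ((2 : ℝ) - n)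
    have h3 : fderiv ℝ (fun y : ES n => (2 - (n : ℝ)) * ((‖y‖ ^ n)⁻¹ * y i)) x = _ := h2.fderiv
    rw [h3]
    simp [EuclideanSpace.inner_single_right]
    ring
  rw [lap, Finset.sum_congr rfl fun i _ => hterm i, ← Finset.mul_sum, Finset.sum_sub_distrib,
    ← Finset.mul_sum, ← EuclideanSpace.real_norm_sq_eq]
  simp only [Finset.sum_const, Finset.card_univ, Fintype.card_fin, nsmul_eq_mul]
  field_simp
  ring

section Potential

variable {n : ℕ} {ι : Type} {a : ι → ℝ} {p : ι → ES n} {K : Set (ES n)}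

/-- The potential of the point charges `a i` placed at the points `p i`. -/
def chargePotential (n : ℕ) {ι : Type} (a : ι → ℝ) (p : ι → ES n) (x : ES n) : ℝ :=
  ∑' i, a i * pointPotential n (x - p i)

theorem summable_mul_pointPotential (ha : Summable fun i => |a i|) (hK : IsCompact K)
    (hp : ∀ i, p i ∈ K) {x : ES n} (hx : x ∉ K) :
    Summable fun i => a i * pointPotential n (x - p i) :=
  summable_smul_translate (contDiffOn_pointPotential n 0).continuousOn ha hK hp hx

theorem fderiv_chargePotential_apply (ha : Summable fun i => |a i|) (hK : IsCompact K)
    (hp : ∀ i, p i ∈ K) {x : ES n} (hx : x ∉ K) (v : ES n) :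
    HasSum (fun i => a i * fderiv ℝ (pointPotential n) (x - p i) v)
      (fderiv ℝ (chargePotential n a p) x v) :=
  hasSum_fderiv_smul_translate_apply (by exact_mod_cast contDiffOn_pointPotential n 1) ha hK hp
    hx v

theorem contDiffOn_chargePotential (ha : Summable fun i => |a i|) (hK : IsCompact K)
    (hp : ∀ i, p i ∈ K) : ContDiffOn ℝ 2 (chargePotential n a p) Kᶜ :=
  contDiffOn_tsum_smul_translate 2 (contDiffOn_pointPotential n 3) ha hK hp

theorem lap_chargePotential (hn : 2 ≤ n) (ha : Summable fun i => |a i|) (hK : IsCompact K)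
    (hp : ∀ i, p i ∈ K) {x : ES n} (hx : x ∉ K) : lap (chargePotential n a p) x = 0 := by
  let ψ : Fin n → ES n → ℝ := fun j y => fderiv ℝ (pointPotential n) y (EuclideanSpace.single j 1)
  have hψ : ∀ j, ContDiffOn ℝ 1 (ψ j) {0}ᶜ := fun j =>
    ((contDiffOn_pointPotential n 2).fderiv_of_isOpen isOpen_compl_singleton
      (by norm_num)).clm_apply contDiffOn_const
  have hterm : ∀ j, HasSum (fun i => a i * fderiv ℝ (ψ j) (x - p i) (EuclideanSpace.single j 1))
      (fderiv ℝ (fun y => fderiv ℝ (chargePotential n a p) y (EuclideanSpace.single j 1)) x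
        (EuclideanSpace.single j 1)) := by
    intro j
    have heq : (fun y => fderiv ℝ (chargePotential n a p) y (EuclideanSpace.single j 1)) =ᶠ[𝓝 x]
        fun y => ∑' i, a i • ψ j (y - p i) := by
      filter_upwards [hK.isClosed.isOpen_compl.mem_nhds hx] with y hy
      exact (fderiv_chargePotential_apply ha hK hp hy _).tsum_eq.symm
    rw [heq.fderiv_eq]
    exact hasSum_fderiv_smul_translate_apply (hψ j) ha hK hp hx _
  have hsum := hasSum_sum fun j (_ : j ∈ Finset.univ) => hterm j
  rw [lap, ← hsum.tsum_eq]
  have hzero : ∀ i, ∑ j, a i * fderiv ℝ (ψ j) (x - p i) (EuclideanSpace.single j 1) = 0 := by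
    intro i
    have hne : x - p i ≠ 0 := fun h => hx (sub_eq_zero.1 h ▸ hp i)
    rw [← Finset.mul_sum]
    exact mul_eq_zero_of_right _ (lap_pointPotential hn hne)
  simp only [hzero, tsum_zero]

/-- Each charge contributes `(2 - n) ωₙ` to the flux through a sphere that encloses it, and nothing
otherwise. -/
theorem integral_sphere_fderiv_pointPotential (hn : 2 ≤ n) {c q : ES n} {r : ℝ} (hr : 0 < r)
    (hq : dist q c ≠ r) :
    ∫ x in sphere c r, fderiv ℝ (pointPotential n) (x - q) (r⁻¹ • (x - c)) ∂μH[(n - 1 : ℝ)] =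
      if dist q c < r then (2 - n) * sphereArea n else 0 := by
  have htrans := ((IsometryEquiv.addRight c).measurePreserving_hausdorffMeasure
    (n - 1 : ℝ)).setIntegral_preimage_emb (IsometryEquiv.addRight c).toHomeomorph.measurableEmbedding
    (fun x => fderiv ℝ (pointPotential n) (x - q) (r⁻¹ • (x - c))) (sphere c r)
  have hpre : IsometryEquiv.addRight c ⁻¹' sphere c r = sphere 0 r := by
    ext x
    simp
  rw [hpre] at htrans
  rw [← htrans]
  have hdist : dist q c = ‖q - c‖ := dist_eq_norm q c
  rw [hdist] at hq ⊢
  have hcongr : ∀ x ∈ sphere (0 : ES n) r, fderiv ℝ (pointPotential n)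
      (IsometryEquiv.addRight c x - q) (r⁻¹ • (IsometryEquiv.addRight c x - c)) =
        (2 - n) * r⁻¹ * ((‖x - (q - c)‖ ^ n)⁻¹ * ⟪x - (q - c), x⟫) := by
    intro x hx
    rw [mem_sphere_zero_iff_norm] at hx
    have hne : x - (q - c) ≠ 0 := by
      intro h
      rw [sub_eq_zero] at h
      exact hq (h ▸ hx)
    rw [IsometryEquiv.addRight_apply, add_sub_cancel_right, show x + c - q = x - (q - c) by abel,
      fderiv_pointPotential hn hne, real_inner_smul_right]
    ring
  rw [setIntegral_congr_fun isClosed_sphere.measurableSet hcongr, integral_const_mul,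
    integral_sphere_flux_kernel hn hr _ hq]
  split_ifs with h
  · field_simp
  · simp

theorem hausdorffMeasure_sphere_lt_top' (hn : 1 ≤ n) (c : ES n) {r : ℝ} (hr : 0 < r) :
    μH[(n - 1 : ℝ)] (sphere c r) < ⊤ := by
  have hpre : IsometryEquiv.addRight c ⁻¹' sphere c r = sphere 0 r := by
    ext x
    simp
  rw [← IsometryEquiv.hausdorffMeasure_preimage (IsometryEquiv.addRight c), hpre]
  exact hausdorffMeasure_sphere_lt_top hn hr

theorem flux_eq_setIntegral_fderiv (u : ES n → ℝ) (c : ES n) (r : ℝ) :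
    flux u c r = ∫ x in sphere c r, fderiv ℝ u x (r⁻¹ • (x - c)) ∂μH[(n - 1 : ℝ)] := by
  simp only [flux, fluxW, mul_one, inner_gradient_left]

theorem flux_chargePotential [Countable ι] (hn : 2 ≤ n) (ha : Summable fun i => |a i|) (hK : IsCompact K)
    (hp : ∀ i, p i ∈ K) {c : ES n} {r : ℝ} (hr : 0 < r) (hS : Disjoint (sphere c r) K) :
    flux (chargePotential n a p) c r =
      (2 - n) * sphereArea n * ∑' i, if dist (p i) c < r then a i else 0 := by
  have hn1 : 1 ≤ n := by omega
  have hfin : IsFiniteMeasure (μH[(n - 1 : ℝ)].restrict (sphere c r)) :=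
    ⟨by simpa using hausdorffMeasure_sphere_lt_top' hn1 c hr⟩
  have hms : MeasurableSet (sphere c r) := isClosed_sphere.measurableSet
  have hnS : ∀ x ∈ sphere c r, ‖r⁻¹ • (x - c)‖ = 1 := by
    intro x hx
    rw [mem_sphere_iff_norm] at hx
    rw [norm_smul, hx, norm_inv, Real.norm_of_nonneg hr.le, inv_mul_cancel₀ hr.ne']
  have hfc : ContinuousOn (fderiv ℝ (pointPotential n)) {0}ᶜ :=
    (contDiffOn_pointPotential n 1).continuousOn_fderiv_of_isOpen isOpen_compl_singleton
      (by norm_num)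
  obtain ⟨C, hC⟩ := exists_bound_comp_sub hfc hK (isCompact_sphere c r) hS
  have hsum := hasSum_integral_of_dominated_convergence
    (μ := μH[(n - 1 : ℝ)].restrict (sphere c r))
    (F := fun i x => a i * fderiv ℝ (pointPotential n) (x - p i) (r⁻¹ • (x - c)))
    (f := fun x => fderiv ℝ (chargePotential n a p) x (r⁻¹ • (x - c)))
    (fun i _ => |a i| * C) ?_ ?_ ?_ ?_ ?_
  · rw [flux_eq_setIntegral_fderiv, ← hsum.tsum_eq, ← tsum_mul_left]
    refine tsum_congr fun i => ?_
    have hne : dist (p i) c ≠ r := fun h => Set.disjoint_left.1 hS h (hp i)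
    rw [integral_const_mul, integral_sphere_fderiv_pointPotential hn hr hne]
    split_ifs <;> ring
  · intro i
    have hmaps : Set.MapsTo (fun x => x - p i) (sphere c r) {0}ᶜ := by
      intro x hx h
      rw [Set.mem_singleton_iff, sub_eq_zero] at h
      exact Set.disjoint_left.1 hS hx (h ▸ hp i)
    have hcont : ContinuousOn (fun x => fderiv ℝ (pointPotential n) (x - p i) (r⁻¹ • (x - c)))
        (sphere c r) := (hfc.comp (by fun_prop) hmaps).clm_apply (by fun_prop)
    exact (continuousOn_const.mul hcont).aestronglyMeasurable hms
  · intro i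
    filter_upwards [ae_restrict_mem hms] with x hx
    rw [norm_mul, Real.norm_eq_abs]
    refine mul_le_mul_of_nonneg_left ?_ (abs_nonneg _)
    refine (ContinuousLinearMap.le_opNorm _ _).trans ?_
    rw [hnS x hx, mul_one]
    exact hC x hx _ (hp i)
  · exact Eventually.of_forall fun _ => ha.mul_right C
  · exact integrable_const _
  · filter_upwards [ae_restrict_mem hms] with x hx
    exact fderiv_chargePotential_apply ha hK hp (Set.disjoint_left.1 hS hx) _

theorem abs_pointPotential_sub_le (hn : 2 ≤ n) {R : ℝ} {x q : ES n} (hq : ‖q‖ ≤ R) (hx0 : x ≠ 0)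
    (hx : 2 * R ≤ ‖x‖) :
    |pointPotential n (x - q) - pointPotential n x| ≤
      ((n - 2) * 2 ^ (n - 1) * R) * (‖x‖ ^ (n - 1))⁻¹ := by
  have hxpos : 0 < ‖x‖ := norm_pos_iff.2 hx0
  have hR : 0 ≤ R := (norm_nonneg q).trans hq
  have hn2 : (0 : ℝ) ≤ n - 2 := by
    have : (2 : ℝ) ≤ n := by exact_mod_cast hn
    linarith
  have hlow : ∀ y ∈ closedBall x R, ‖x‖ / 2 ≤ ‖y‖ := by
    intro y hy
    rw [mem_closedBall, dist_comm, dist_eq_norm] at hy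
    have := norm_sub_norm_le x y
    linarith
  have hne : ∀ y ∈ closedBall x R, y ≠ 0 := fun y hy =>
    norm_pos_iff.1 ((half_pos hxpos).trans_le (hlow y hy))
  have hder : ∀ y ∈ closedBall x R,
      ‖fderiv ℝ (pointPotential n) y‖ ≤ (n - 2) * 2 ^ (n - 1) * (‖x‖ ^ (n - 1))⁻¹ := by
    intro y hy
    have hypos : 0 < ‖y‖ := norm_pos_iff.2 (hne y hy)
    have hnn : (0 : ℝ) ≤ (n - 2) * 2 ^ (n - 1) * (‖x‖ ^ (n - 1))⁻¹ := by positivity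
    refine ContinuousLinearMap.opNorm_le_bound _ hnn fun v => ?_
    rw [fderiv_pointPotential hn (hne y hy), norm_mul, norm_mul]
    have h1 : ‖(2 : ℝ) - n‖ = n - 2 := by
      rw [norm_sub_rev, Real.norm_of_nonneg hn2]
    have h2 : ‖(‖y‖ ^ n)⁻¹‖ = (‖y‖ ^ (n - 1))⁻¹ * ‖y‖⁻¹ := by
      rw [norm_inv, norm_pow, norm_norm, ← mul_inv, ← pow_succ, Nat.sub_add_cancel (by omega)]
    have h3 : (‖y‖ ^ (n - 1))⁻¹ ≤ 2 ^ (n - 1) * (‖x‖ ^ (n - 1))⁻¹ := by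
      calc (‖y‖ ^ (n - 1))⁻¹ ≤ ((‖x‖ / 2) ^ (n - 1))⁻¹ :=
            inv_anti₀ (by positivity) (pow_le_pow_left₀ (by positivity) (hlow y hy) _)
        _ = _ := by rw [div_pow, inv_div, div_eq_mul_inv]
    rw [h1, h2]
    calc (n - 2) * ((‖y‖ ^ (n - 1))⁻¹ * ‖y‖⁻¹ * ‖⟪y, v⟫‖)
        ≤ (n - 2) * ((‖y‖ ^ (n - 1))⁻¹ * ‖y‖⁻¹ * (‖y‖ * ‖v‖)) := by
          gcongr
          exact norm_inner_le_norm y v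
      _ = (n - 2) * (‖y‖ ^ (n - 1))⁻¹ * ‖v‖ := by field_simp
      _ ≤ (n - 2) * (2 ^ (n - 1) * (‖x‖ ^ (n - 1))⁻¹) * ‖v‖ := by gcongr
      _ = _ := by ring
  have hmem : x - q ∈ closedBall x R := by
    rw [mem_closedBall, dist_eq_norm]
    simpa using hq
  have hdiff : ∀ y ∈ closedBall x R, DifferentiableAt ℝ (pointPotential n) y := fun y hy =>
    (hasFDerivAt_inv_norm_pow (n - 2) (hne y hy)).differentiableAt
  have h := (convex_closedBall x R).norm_image_sub_le_of_norm_fderiv_le hdiff hder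
    (mem_closedBall_self hR) hmem
  rw [Real.norm_eq_abs] at h
  refine h.trans ?_
  have hq' : ‖x - q - x‖ ≤ R := by simpa using hq
  calc _ ≤ (n - 2) * 2 ^ (n - 1) * (‖x‖ ^ (n - 1))⁻¹ * R := by gcongr
    _ = _ := by ring

/-- A bounded system of charges looks from infinity like its total charge placed at the origin. -/
theorem chargePotential_sub_isBigO (hn : 2 ≤ n) (ha : Summable fun i => |a i|) (hK : IsCompact K)
    (hp : ∀ i, p i ∈ K) :
    (fun x => chargePotential n a p x - (∑' i, a i) * pointPotential n x)
      =O[Bornology.cobounded (ES n)] fun x => ‖x‖ ^ (1 - (n : ℝ)) := by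
  obtain ⟨R, hR⟩ := hK.isBounded.exists_norm_le
  refine IsBigO.of_bound ((∑' i, |a i|) * ((n - 2) * 2 ^ (n - 1) * R)) ?_
  have hfar : ∀ᶠ x : ES n in Bornology.cobounded (ES n), max (2 * R) 0 + 1 ≤ ‖x‖ ∧ x ∈ Kᶜ :=
    (tendsto_norm_cobounded_atTop.eventually_ge_atTop _).and hK.isBounded
  filter_upwards [hfar] with x ⟨hx, hxK⟩
  have hx1 : 2 * R ≤ ‖x‖ := by linarith [le_max_left (2 * R) 0]
  have hxpos : 0 < ‖x‖ := by linarith [le_max_right (2 * R) 0]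
  have hpow : ‖x‖ ^ (1 - (n : ℝ)) = (‖x‖ ^ (n - 1))⁻¹ := by
    rw [← Real.rpow_natCast, ← Real.rpow_neg hxpos.le, Nat.cast_sub (by omega)]
    congr 1
    push_cast
    ring
  rw [Real.norm_of_nonneg (Real.rpow_nonneg (norm_nonneg x) _), hpow, chargePotential,
    ← tsum_mul_right, ← (summable_mul_pointPotential ha hK hp hxK).tsum_sub (ha.of_abs.mul_right _)]
  have hle : ∀ i, ‖a i * pointPotential n (x - p i) - a i * pointPotential n x‖ ≤
      |a i| * (((n - 2) * 2 ^ (n - 1) * R) * (‖x‖ ^ (n - 1))⁻¹) := by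
    intro i
    rw [← mul_sub, norm_mul, Real.norm_eq_abs, Real.norm_eq_abs]
    exact mul_le_mul_of_nonneg_left
      (abs_pointPotential_sub_le hn (hR _ (hp i)) (norm_pos_iff.1 hxpos) hx1) (abs_nonneg _)
  have hsum := ha.mul_right (((n - 2) * 2 ^ (n - 1) * R) * (‖x‖ ^ (n - 1))⁻¹)
  refine (tsum_of_norm_bounded hsum.hasSum hle).trans ?_
  rw [tsum_mul_right]
  exact le_of_eq (by ring)

end Potential

section Images

variable {n : ℕ} {c₁ c₂ : ES n} {r₁ r₂ : ℝ}

theorem reflBall_eq_inversion (c : ES n) (r : ℝ) (x : ES n) :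
    reflBall c r x = EuclideanGeometry.inversion c r x := by
  rw [reflBall, EuclideanGeometry.inversion, dist_eq_norm, div_pow, vsub_eq_sub, vadd_eq_add,
    add_comm]

/-- Reflecting a charge `t ^ (n - 2)` in a sphere, with the appropriate factor, does not change its
potential on that sphere. -/
theorem pointPotential_sub_reflBall {c : ES n} {r : ℝ} (hr : 0 < r) {x y : ES n}
    (hx : x ∈ sphere c r) (hy : y ≠ c) (t : ℝ) :
    (t * (r / ‖c - y‖)) ^ (n - 2) * pointPotential n (x - reflBall c r y) =
      t ^ (n - 2) * pointPotential n (x - y) := by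
  have hxc : x ≠ c := fun h => by simp [h, hr.ne] at hx
  have h := EuclideanGeometry.dist_inversion_mul_dist_center_eq (R := r) hxc hy
  rw [EuclideanGeometry.inversion_of_mem_sphere hx, ← reflBall_eq_inversion, mem_sphere.1 hx,
    dist_comm y c, dist_eq_norm, dist_eq_norm, dist_eq_norm] at h
  have hcy : ‖c - y‖ ≠ 0 := norm_ne_zero_iff.2 (sub_ne_zero.2 hy.symm)
  have h' : ‖x - reflBall c r y‖ = ‖x - y‖ * (r / ‖c - y‖) := by
    rw [mul_div_assoc', eq_div_iff hcy, ← h]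
  rw [pointPotential, pointPotential, h', mul_pow, mul_pow, mul_inv]
  have : (r / ‖c - y‖) ^ (n - 2) ≠ 0 := by positivity
  field_simp

/-- The ball of radius `r₁ ^ 2 / (dist c₁ c₂ - r₂)` about `c₁` contains the image of the second ball
under the reflection in the first sphere. -/
def imageBall (c₁ c₂ : ES n) (r₁ r₂ : ℝ) : Set (ES n) :=
  closedBall c₁ (r₁ ^ 2 / (dist c₁ c₂ - r₂))

theorem imageRadius_lt (h₁ : 0 < r₁) (hd : r₁ + r₂ < dist c₁ c₂) :
    r₁ ^ 2 / (dist c₁ c₂ - r₂) < r₁ := by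
  rw [div_lt_iff₀ (by linarith), sq]
  exact mul_lt_mul_of_pos_left (by linarith) h₁

theorem imageBall_subset_ball (h₁ : 0 < r₁) (hd : r₁ + r₂ < dist c₁ c₂) :
    imageBall c₁ c₂ r₁ r₂ ⊆ ball c₁ r₁ :=
  closedBall_subset_ball (imageRadius_lt h₁ hd)

theorem center_mem_imageBall (h₁ : 0 < r₁) (hd : r₁ + r₂ < dist c₁ c₂) :
    c₁ ∈ imageBall c₁ c₂ r₁ r₂ :=
  mem_closedBall_self (div_nonneg (sq_nonneg _) (by linarith))

theorem sub_le_dist_of_mem_ball {y : ES n} (hy : y ∈ ball c₂ r₂) :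
    dist c₁ c₂ - r₂ ≤ dist c₁ y := by
  linarith [dist_triangle c₁ y c₂, mem_ball.1 hy]

theorem reflBall_mem_imageBall (h₁ : 0 < r₁) (hd : r₁ + r₂ < dist c₁ c₂) {y : ES n}
    (hy : y ∈ ball c₂ r₂) : reflBall c₁ r₁ y ∈ imageBall c₁ c₂ r₁ r₂ := by
  rw [imageBall, mem_closedBall, reflBall_eq_inversion, EuclideanGeometry.dist_inversion_center,
    dist_comm y]
  exact div_le_div_of_nonneg_left (sq_nonneg _) (by linarith) (sub_le_dist_of_mem_ball hy)

theorem cSeq_two_mul_add_one (k : ℕ) :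
    cSeq c₁ c₂ r₁ r₂ (2 * k + 1) = reflBall c₂ r₂ (cSeq c₁ c₂ r₁ r₂ (2 * k)) := by
  rw [cSeq, if_pos (by omega)]

theorem cSeq_two_mul_add_two (k : ℕ) :
    cSeq c₁ c₂ r₁ r₂ (2 * k + 2) = reflBall c₁ r₁ (cSeq c₁ c₂ r₁ r₂ (2 * k + 1)) := by
  rw [cSeq, if_neg (by omega)]

theorem qSeq_zero : qSeq c₁ c₂ r₁ r₂ 0 = 1 := by
  simp [qSeq, rhoSeq]

theorem qSeq_succ (m : ℕ) :
    qSeq c₁ c₂ r₁ r₂ (m + 1) = qSeq c₁ c₂ r₁ r₂ m * rhoSeq c₁ c₂ r₁ r₂ (m + 1) :=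
  Finset.prod_range_succ _ _

theorem rhoSeq_two_mul_add_one (k : ℕ) :
    rhoSeq c₁ c₂ r₁ r₂ (2 * k + 1) = r₂ / ‖c₂ - cSeq c₁ c₂ r₁ r₂ (2 * k)‖ := by
  rw [rhoSeq, if_pos (by omega)]

theorem rhoSeq_two_mul_add_two (k : ℕ) :
    rhoSeq c₁ c₂ r₁ r₂ (2 * k + 2) = r₁ / ‖c₁ - cSeq c₁ c₂ r₁ r₂ (2 * k + 1)‖ := by
  rw [rhoSeq, if_neg (by omega)]

theorem cSeq_two_mul_mem (h₁ : 0 < r₁) (h₂ : 0 < r₂) (hd : r₁ + r₂ < dist c₁ c₂) (k : ℕ) :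
    cSeq c₁ c₂ r₁ r₂ (2 * k) ∈ imageBall c₁ c₂ r₁ r₂ := by
  have hd' : r₂ + r₁ < dist c₂ c₁ := by rwa [add_comm, dist_comm]
  induction k with
  | zero => exact center_mem_imageBall h₁ hd
  | succ k ih =>
    rw [mul_add, mul_one, cSeq_two_mul_add_two, cSeq_two_mul_add_one]
    exact reflBall_mem_imageBall h₁ hd (imageBall_subset_ball h₂ hd'
      (reflBall_mem_imageBall h₂ hd' (imageBall_subset_ball h₁ hd ih)))

theorem cSeq_two_mul_add_one_mem (h₁ : 0 < r₁) (h₂ : 0 < r₂) (hd : r₁ + r₂ < dist c₁ c₂)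
    (k : ℕ) : cSeq c₁ c₂ r₁ r₂ (2 * k + 1) ∈ imageBall c₂ c₁ r₂ r₁ := by
  have hd' : r₂ + r₁ < dist c₂ c₁ := by rwa [add_comm, dist_comm]
  rw [cSeq_two_mul_add_one]
  exact reflBall_mem_imageBall h₂ hd' (imageBall_subset_ball h₁ hd (cSeq_two_mul_mem h₁ h₂ hd k))

theorem cSeq_mem (h₁ : 0 < r₁) (h₂ : 0 < r₂) (hd : r₁ + r₂ < dist c₁ c₂) (m : ℕ) :
    cSeq c₁ c₂ r₁ r₂ m ∈ imageBall c₁ c₂ r₁ r₂ ∪ imageBall c₂ c₁ r₂ r₁ := by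
  obtain ⟨k, rfl | rfl⟩ := m.even_or_odd'
  · exact Or.inl (cSeq_two_mul_mem h₁ h₂ hd k)
  · exact Or.inr (cSeq_two_mul_add_one_mem h₁ h₂ hd k)

theorem rhoSeq_succ_pos (h₁ : 0 < r₁) (h₂ : 0 < r₂) (hd : r₁ + r₂ < dist c₁ c₂) (m : ℕ) :
    0 < rhoSeq c₁ c₂ r₁ r₂ (m + 1) := by
  have hd' : r₂ + r₁ < dist c₂ c₁ := by rwa [add_comm, dist_comm]
  obtain ⟨k, rfl | rfl⟩ := m.even_or_odd'
  · rw [rhoSeq_two_mul_add_one, ← dist_eq_norm]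
    have := sub_le_dist_of_mem_ball (c₁ := c₂)
      (imageBall_subset_ball h₁ hd (cSeq_two_mul_mem h₁ h₂ hd k))
    exact div_pos h₂ (by linarith)
  · rw [rhoSeq_two_mul_add_two, ← dist_eq_norm]
    have := sub_le_dist_of_mem_ball (c₁ := c₁)
      (imageBall_subset_ball h₂ hd' (cSeq_two_mul_add_one_mem h₁ h₂ hd k))
    exact div_pos h₁ (by linarith)

theorem exists_rhoSeq_succ_le (h₁ : 0 < r₁) (h₂ : 0 < r₂) (hd : r₁ + r₂ < dist c₁ c₂) :
    ∃ θ < 1, ∀ m, rhoSeq c₁ c₂ r₁ r₂ (m + 1) ≤ θ := by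
  have hd' : r₂ + r₁ < dist c₂ c₁ := by rwa [add_comm, dist_comm]
  refine ⟨max (r₂ / (dist c₂ c₁ - r₁)) (r₁ / (dist c₁ c₂ - r₂)), max_lt ?_ ?_, fun m => ?_⟩
  · rw [div_lt_one (by linarith)]
    linarith
  · rw [div_lt_one (by linarith)]
    linarith
  obtain ⟨k, rfl | rfl⟩ := m.even_or_odd'
  · rw [rhoSeq_two_mul_add_one, ← dist_eq_norm]
    exact (div_le_div_of_nonneg_left h₂.le (by linarith) (sub_le_dist_of_mem_ball
      (imageBall_subset_ball h₁ hd (cSeq_two_mul_mem h₁ h₂ hd k)))).trans (le_max_left _ _)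
  · rw [rhoSeq_two_mul_add_two, ← dist_eq_norm]
    exact (div_le_div_of_nonneg_left h₁.le (by linarith) (sub_le_dist_of_mem_ball
      (imageBall_subset_ball h₂ hd' (cSeq_two_mul_add_one_mem h₁ h₂ hd k)))).trans
      (le_max_right _ _)

theorem qSeq_pos (h₁ : 0 < r₁) (h₂ : 0 < r₂) (hd : r₁ + r₂ < dist c₁ c₂) (m : ℕ) :
    0 < qSeq c₁ c₂ r₁ r₂ m := by
  induction m with
  | zero => simp [qSeq_zero]
  | succ m ih => exact qSeq_succ (c₁ := c₁) m ▸ mul_pos ih (rhoSeq_succ_pos h₁ h₂ hd m)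

theorem qSeq_succ_lt (h₁ : 0 < r₁) (h₂ : 0 < r₂) (hd : r₁ + r₂ < dist c₁ c₂) (m : ℕ) :
    qSeq c₁ c₂ r₁ r₂ (m + 1) < qSeq c₁ c₂ r₁ r₂ m := by
  obtain ⟨θ, hθ, hle⟩ := exists_rhoSeq_succ_le h₁ h₂ hd
  rw [qSeq_succ]
  exact mul_lt_of_lt_one_right (qSeq_pos h₁ h₂ hd m) ((hle m).trans_lt hθ)

theorem summable_qSeq_pow (h₁ : 0 < r₁) (h₂ : 0 < r₂) (hd : r₁ + r₂ < dist c₁ c₂) {k : ℕ}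
    (hk : k ≠ 0) : Summable fun m => qSeq c₁ c₂ r₁ r₂ m ^ k := by
  obtain ⟨θ, hθ, hle⟩ := exists_rhoSeq_succ_le h₁ h₂ hd
  have hθ0 : 0 < θ := (rhoSeq_succ_pos h₁ h₂ hd 0).trans_le (hle 0)
  have hq : ∀ m, qSeq c₁ c₂ r₁ r₂ m ≤ θ ^ m := by
    intro m
    induction m with
    | zero => simp [qSeq_zero]
    | succ m ih =>
      rw [qSeq_succ, pow_succ]
      exact mul_le_mul ih (hle m) (rhoSeq_succ_pos h₁ h₂ hd m).le (by positivity)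
  refine (summable_geometric_of_lt_one hθ0.le hθ).of_nonneg_of_le
    (fun m => pow_nonneg (qSeq_pos h₁ h₂ hd m).le _) fun m => ?_
  exact (pow_le_of_le_one (qSeq_pos h₁ h₂ hd m).le
    ((hq m).trans (pow_le_one₀ hθ0.le hθ.le)) hk).trans (hq m)

/-- The image charges `(-1) ^ m * q_m ^ (n - 2)`. -/
def imageCharge (c₁ c₂ : ES n) (r₁ r₂ : ℝ) (m : ℕ) : ℝ :=
  (-1) ^ m * qSeq c₁ c₂ r₁ r₂ m ^ (n - 2)

theorem abs_imageCharge (h₁ : 0 < r₁) (h₂ : 0 < r₂) (hd : r₁ + r₂ < dist c₁ c₂) (m : ℕ) :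
    |imageCharge c₁ c₂ r₁ r₂ m| = qSeq c₁ c₂ r₁ r₂ m ^ (n - 2) := by
  rw [imageCharge, abs_mul, abs_pow, abs_neg, abs_one, one_pow, one_mul,
    abs_of_pos (pow_pos (qSeq_pos h₁ h₂ hd m) _)]

theorem summable_abs_imageCharge (hn : 3 ≤ n) (h₁ : 0 < r₁) (h₂ : 0 < r₂)
    (hd : r₁ + r₂ < dist c₁ c₂) : Summable fun m => |imageCharge c₁ c₂ r₁ r₂ m| := by
  simp only [abs_imageCharge h₁ h₂ hd]
  exact summable_qSeq_pow h₁ h₂ hd (by omega)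

theorem imageCharge_two_mul (k : ℕ) :
    imageCharge c₁ c₂ r₁ r₂ (2 * k) = qSeq c₁ c₂ r₁ r₂ (2 * k) ^ (n - 2) := by
  simp [imageCharge, pow_mul]

theorem imageCharge_two_mul_add_one (k : ℕ) :
    imageCharge c₁ c₂ r₁ r₂ (2 * k + 1) = -qSeq c₁ c₂ r₁ r₂ (2 * k + 1) ^ (n - 2) := by
  simp [imageCharge, pow_succ, pow_mul]

theorem imageCharge_two_mul_add_two (k : ℕ) :
    imageCharge c₁ c₂ r₁ r₂ (2 * k + 2) = qSeq c₁ c₂ r₁ r₂ (2 * k + 2) ^ (n - 2) :=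
  imageCharge_two_mul (k + 1)

theorem summable_qSeq_pow_two_mul (h₁ : 0 < r₁) (h₂ : 0 < r₂) (hd : r₁ + r₂ < dist c₁ c₂) {k : ℕ}
    (hk : k ≠ 0) : Summable fun m => qSeq c₁ c₂ r₁ r₂ (2 * m) ^ k :=
  (summable_qSeq_pow h₁ h₂ hd hk).comp_injective (i := fun m => 2 * m) fun _ _ h => by
    simpa using h

theorem summable_qSeq_pow_two_mul_add_one (h₁ : 0 < r₁) (h₂ : 0 < r₂)
    (hd : r₁ + r₂ < dist c₁ c₂) {k : ℕ} (hk : k ≠ 0) :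
    Summable fun m => qSeq c₁ c₂ r₁ r₂ (2 * m + 1) ^ k :=
  (summable_qSeq_pow h₁ h₂ hd hk).comp_injective (i := fun m => 2 * m + 1) fun _ _ h => by
    simpa using h

theorem tsum_eq_even_add_odd {f : ℕ → ℝ} (hf : Summable f) :
    ∑' m, f m = ∑' k, f (2 * k) + ∑' k, f (2 * k + 1) :=
  (tsum_even_add_odd
    (hf.comp_injective (i := fun k => 2 * k) fun _ _ h => by simpa using h)
    (hf.comp_injective (i := fun k => 2 * k + 1) fun _ _ h => by simpa using h)).symm

theorem QSum_eq_sub (hn : 3 ≤ n) (h₁ : 0 < r₁) (h₂ : 0 < r₂) (hd : r₁ + r₂ < dist c₁ c₂) :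
    QSum n c₁ c₂ r₁ r₂ = ∑' k, qSeq c₁ c₂ r₁ r₂ (2 * k) ^ (n - 2) -
      ∑' k, qSeq c₁ c₂ r₁ r₂ (2 * k + 1) ^ (n - 2) := by
  refine (tsum_eq_even_add_odd (summable_abs_imageCharge hn h₁ h₂ hd).of_abs).trans ?_
  simp only [imageCharge_two_mul, imageCharge_two_mul_add_one, tsum_neg, sub_eq_add_neg]

theorem QSum_pos (hn : 3 ≤ n) (h₁ : 0 < r₁) (h₂ : 0 < r₂) (hd : r₁ + r₂ < dist c₁ c₂) :
    0 < QSum n c₁ c₂ r₁ r₂ := by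
  have hk : n - 2 ≠ 0 := by omega
  rw [QSum_eq_sub hn h₁ h₂ hd, sub_pos]
  have hlt : ∀ k, qSeq c₁ c₂ r₁ r₂ (2 * k + 1) ^ (n - 2) < qSeq c₁ c₂ r₁ r₂ (2 * k) ^ (n - 2) :=
    fun k => pow_lt_pow_left₀ (qSeq_succ_lt h₁ h₂ hd _) (qSeq_pos h₁ h₂ hd _).le hk
  exact Summable.tsum_lt_tsum (i := 0) (fun k => (hlt k).le) (hlt 0)
    (summable_qSeq_pow_two_mul_add_one h₁ h₂ hd hk) (summable_qSeq_pow_two_mul h₁ h₂ hd hk)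

theorem MSum_pos (hn : 3 ≤ n) (h₁ : 0 < r₁) (h₂ : 0 < r₂) (hd : r₁ + r₂ < dist c₁ c₂) :
    0 < MSum n c₁ c₂ r₁ r₂ := by
  have hd' : r₂ + r₁ < dist c₂ c₁ := by rwa [add_comm, dist_comm]
  have hk : n - 2 ≠ 0 := by omega
  refine add_pos (mul_pos (QSum_pos hn h₂ h₁ hd') ?_) (mul_pos (QSum_pos hn h₁ h₂ hd) ?_)
  · exact (summable_qSeq_pow_two_mul h₁ h₂ hd hk).tsum_pos
      (fun k => (pow_pos (qSeq_pos h₁ h₂ hd _) _).le) 0 (pow_pos (qSeq_pos h₁ h₂ hd _) _)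
  · exact (summable_qSeq_pow_two_mul_add_one h₂ h₁ hd' hk).tsum_pos
      (fun k => (pow_pos (qSeq_pos h₂ h₁ hd' _) _).le) 0 (pow_pos (qSeq_pos h₂ h₁ hd' _) _)

theorem MSum_swap (hn : 3 ≤ n) (h₁ : 0 < r₁) (h₂ : 0 < r₂) (hd : r₁ + r₂ < dist c₁ c₂) :
    MSum n c₂ c₁ r₂ r₁ = MSum n c₁ c₂ r₁ r₂ := by
  have hd' : r₂ + r₁ < dist c₂ c₁ := by rwa [add_comm, dist_comm]
  rw [MSum, MSum, QSum_eq_sub hn h₁ h₂ hd, QSum_eq_sub hn h₂ h₁ hd']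
  ring

theorem hFun_swap (hn : 3 ≤ n) (h₁ : 0 < r₁) (h₂ : 0 < r₂) (hd : r₁ + r₂ < dist c₁ c₂) :
    hFun n c₂ c₁ r₂ r₁ = -hFun n c₁ c₂ r₁ r₂ := by
  ext x
  rw [Pi.neg_apply, hFun, hFun, MSum_swap hn h₁ h₂ hd]
  ring

theorem hFun_eq (x : ES n) :
    hFun n c₁ c₂ r₁ r₂ x = (1 / ((2 - (n : ℝ)) * sphereArea n * MSum n c₁ c₂ r₁ r₂)) *
      (QSum n c₂ c₁ r₂ r₁ *
          chargePotential n (imageCharge c₁ c₂ r₁ r₂) (cSeq c₁ c₂ r₁ r₂) x -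
        QSum n c₁ c₂ r₁ r₂ *
          chargePotential n (imageCharge c₂ c₁ r₂ r₁) (cSeq c₂ c₁ r₂ r₁) x) :=
  rfl

theorem tsum_eq_zero_of_pairs {f : ℕ → ℝ} (hf : Summable f)
    (h : ∀ k, f (2 * k + 1) = -f (2 * k)) : ∑' m, f m = 0 := by
  simp only [tsum_eq_even_add_odd hf, h, tsum_neg, add_neg_cancel]

theorem isCompact_imageBall : IsCompact (imageBall c₁ c₂ r₁ r₂) :=
  isCompact_closedBall _ _

theorem disjoint_sphere_imageBalls (h₁ : 0 < r₁) (h₂ : 0 < r₂) (hd : r₁ + r₂ < dist c₁ c₂) :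
    Disjoint (sphere c₁ r₁) (imageBall c₁ c₂ r₁ r₂ ∪ imageBall c₂ c₁ r₂ r₁) := by
  have hd' : r₂ + r₁ < dist c₂ c₁ := by rwa [add_comm, dist_comm]
  rw [Set.disjoint_left]
  rintro x hx (h | h)
  · exact (mem_ball.1 (imageBall_subset_ball h₁ hd h)).ne hx
  · have := sub_le_dist_of_mem_ball (c₁ := c₁) (imageBall_subset_ball h₂ hd' h)
    rw [dist_comm c₁ x, mem_sphere.1 hx] at this
    linarith

/-- The first system of image charges has constant potential on the first sphere. -/
theorem chargePotential_cSeq_eq (hn : 3 ≤ n) (h₁ : 0 < r₁) (h₂ : 0 < r₂)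
    (hd : r₁ + r₂ < dist c₁ c₂) {x : ES n} (hx : x ∈ sphere c₁ r₁) :
    chargePotential n (imageCharge c₁ c₂ r₁ r₂) (cSeq c₁ c₂ r₁ r₂) x = (r₁ ^ (n - 2))⁻¹ := by
  have hd' : r₂ + r₁ < dist c₂ c₁ := by rwa [add_comm, dist_comm]
  have hs := summable_mul_pointPotential (summable_abs_imageCharge hn h₁ h₂ hd)
    (isCompact_imageBall.union isCompact_imageBall) (cSeq_mem h₁ h₂ hd)
    (Set.disjoint_left.1 (disjoint_sphere_imageBalls h₁ h₂ hd) hx)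
  rw [chargePotential, hs.tsum_eq_zero_add, tsum_eq_zero_of_pairs ((summable_nat_add_iff 1).2 hs),
    add_zero]
  · rw [mem_sphere_iff_norm] at hx
    simp [imageCharge, qSeq_zero, cSeq, pointPotential, hx]
  · intro k
    have hne : cSeq c₁ c₂ r₁ r₂ (2 * k + 1) ≠ c₁ := by
      intro h
      have := sub_le_dist_of_mem_ball (c₁ := c₁)
        (imageBall_subset_ball h₂ hd' (cSeq_two_mul_add_one_mem h₁ h₂ hd k))
      rw [h, dist_self] at this
      linarith
    rw [show 2 * k + 1 + 1 = 2 * k + 2 from rfl, imageCharge_two_mul_add_two,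
      imageCharge_two_mul_add_one, qSeq_succ, rhoSeq_two_mul_add_two, cSeq_two_mul_add_two,
      pointPotential_sub_reflBall h₁ hx hne, neg_mul, neg_neg]

/-- The second system of image charges has zero potential on the first sphere. -/
theorem chargePotential_cSeq_eq_zero (hn : 3 ≤ n) (h₁ : 0 < r₁) (h₂ : 0 < r₂)
    (hd : r₁ + r₂ < dist c₁ c₂) {x : ES n} (hx : x ∈ sphere c₁ r₁) :
    chargePotential n (imageCharge c₂ c₁ r₂ r₁) (cSeq c₂ c₁ r₂ r₁) x = 0 := by
  have hd' : r₂ + r₁ < dist c₂ c₁ := by rwa [add_comm, dist_comm]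
  refine tsum_eq_zero_of_pairs (summable_mul_pointPotential (summable_abs_imageCharge hn h₂ h₁ hd')
    (isCompact_imageBall.union isCompact_imageBall) (cSeq_mem h₂ h₁ hd') ?_) fun k => ?_
  · rw [Set.union_comm]
    exact Set.disjoint_left.1 (disjoint_sphere_imageBalls h₁ h₂ hd) hx
  · have hne : cSeq c₂ c₁ r₂ r₁ (2 * k) ≠ c₁ := by
      intro h
      have := sub_le_dist_of_mem_ball (c₁ := c₁)
        (imageBall_subset_ball h₂ hd' (cSeq_two_mul_mem h₂ h₁ hd' k))
      rw [h, dist_self] at this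
      linarith
    rw [imageCharge_two_mul_add_one, imageCharge_two_mul, qSeq_succ, rhoSeq_two_mul_add_one,
      cSeq_two_mul_add_one, neg_mul, pointPotential_sub_reflBall h₁ hx hne]

theorem hFun_eq_of_mem_sphere (hn : 3 ≤ n) (h₁ : 0 < r₁) (h₂ : 0 < r₂)
    (hd : r₁ + r₂ < dist c₁ c₂) {x : ES n} (hx : x ∈ sphere c₁ r₁) :
    hFun n c₁ c₂ r₁ r₂ x = (1 / ((2 - (n : ℝ)) * sphereArea n * MSum n c₁ c₂ r₁ r₂)) *
      (QSum n c₂ c₁ r₂ r₁ * (r₁ ^ (n - 2))⁻¹) := by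
  rw [hFun_eq, chargePotential_cSeq_eq hn h₁ h₂ hd hx,
    chargePotential_cSeq_eq_zero hn h₁ h₂ hd hx, mul_zero, sub_zero]

/-- The charges of both systems of images, normalised as in `hFun`. -/
def totalCharge (c₁ c₂ : ES n) (r₁ r₂ : ℝ) : ℕ ⊕ ℕ → ℝ :=
  Sum.elim
    (fun m => QSum n c₂ c₁ r₂ r₁ / ((2 - (n : ℝ)) * sphereArea n * MSum n c₁ c₂ r₁ r₂) *
      imageCharge c₁ c₂ r₁ r₂ m)
    (fun m => -(QSum n c₁ c₂ r₁ r₂ / ((2 - (n : ℝ)) * sphereArea n * MSum n c₁ c₂ r₁ r₂)) *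
      imageCharge c₂ c₁ r₂ r₁ m)

/-- The positions of the charges of both systems of images. -/
def totalPosition (c₁ c₂ : ES n) (r₁ r₂ : ℝ) : ℕ ⊕ ℕ → ES n :=
  Sum.elim (cSeq c₁ c₂ r₁ r₂) (cSeq c₂ c₁ r₂ r₁)

theorem summable_abs_totalCharge (hn : 3 ≤ n) (h₁ : 0 < r₁) (h₂ : 0 < r₂)
    (hd : r₁ + r₂ < dist c₁ c₂) : Summable fun i => |totalCharge c₁ c₂ r₁ r₂ i| := by
  have hd' : r₂ + r₁ < dist c₂ c₁ := by rwa [add_comm, dist_comm]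
  refine Summable.sum _ ?_ ?_
  · simpa [Function.comp_def, totalCharge, abs_mul] using
      (summable_abs_imageCharge hn h₁ h₂ hd).mul_left _
  · simpa [Function.comp_def, totalCharge, abs_mul] using
      (summable_abs_imageCharge hn h₂ h₁ hd').mul_left _

theorem totalPosition_mem (h₁ : 0 < r₁) (h₂ : 0 < r₂) (hd : r₁ + r₂ < dist c₁ c₂) (i : ℕ ⊕ ℕ) :
    totalPosition c₁ c₂ r₁ r₂ i ∈ imageBall c₁ c₂ r₁ r₂ ∪ imageBall c₂ c₁ r₂ r₁ := by
  have hd' : r₂ + r₁ < dist c₂ c₁ := by rwa [add_comm, dist_comm]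
  cases i with
  | inl m => exact cSeq_mem h₁ h₂ hd m
  | inr m => exact Set.union_comm _ _ ▸ cSeq_mem h₂ h₁ hd' m

theorem tsum_sum_type {f : ℕ ⊕ ℕ → ℝ} (hf : Summable f) :
    ∑' i, f i = ∑' m, (f ∘ Sum.inl) m + ∑' m, (f ∘ Sum.inr) m :=
  (HasSum.sum (hf.comp_injective Sum.inl_injective).hasSum
    (hf.comp_injective Sum.inr_injective).hasSum).tsum_eq

theorem hFun_eq_chargePotential (hn : 3 ≤ n) (h₁ : 0 < r₁) (h₂ : 0 < r₂)
    (hd : r₁ + r₂ < dist c₁ c₂) {x : ES n}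
    (hx : x ∉ imageBall c₁ c₂ r₁ r₂ ∪ imageBall c₂ c₁ r₂ r₁) :
    hFun n c₁ c₂ r₁ r₂ x =
      chargePotential n (totalCharge c₁ c₂ r₁ r₂) (totalPosition c₁ c₂ r₁ r₂) x := by
  rw [chargePotential, tsum_sum_type (summable_mul_pointPotential
    (summable_abs_totalCharge hn h₁ h₂ hd) (isCompact_imageBall.union isCompact_imageBall)
    (totalPosition_mem h₁ h₂ hd) hx), hFun_eq, chargePotential, chargePotential]
  simp only [Function.comp_apply, totalCharge, totalPosition, Sum.elim_inl, Sum.elim_inr, mul_assoc, tsum_mul_left]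
  ring

theorem hFun_eventuallyEq (hn : 3 ≤ n) (h₁ : 0 < r₁) (h₂ : 0 < r₂) (hd : r₁ + r₂ < dist c₁ c₂)
    {x : ES n} (hx : x ∉ imageBall c₁ c₂ r₁ r₂ ∪ imageBall c₂ c₁ r₂ r₁) :
    hFun n c₁ c₂ r₁ r₂ =ᶠ[𝓝 x]
      chargePotential n (totalCharge c₁ c₂ r₁ r₂) (totalPosition c₁ c₂ r₁ r₂) := by
  filter_upwards [(isCompact_imageBall.union isCompact_imageBall).isClosed.isOpen_compl.mem_nhds hx]
    with y hy
  exact hFun_eq_chargePotential hn h₁ h₂ hd hy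

theorem harmOn_hFun (hn : 3 ≤ n) (h₁ : 0 < r₁) (h₂ : 0 < r₂) (hd : r₁ + r₂ < dist c₁ c₂) :
    HarmOn (hFun n c₁ c₂ r₁ r₂) (imageBall c₁ c₂ r₁ r₂ ∪ imageBall c₂ c₁ r₂ r₁)ᶜ := by
  have ha := summable_abs_totalCharge hn h₁ h₂ hd
  have hp := totalPosition_mem h₁ h₂ hd
  have hK := (isCompact_imageBall (c₁ := c₁) (c₂ := c₂) (r₁ := r₁) (r₂ := r₂)).union
    (isCompact_imageBall (c₁ := c₂) (c₂ := c₁) (r₁ := r₂) (r₂ := r₁))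
  refine ⟨(contDiffOn_chargePotential ha hK hp).congr fun x hx =>
    hFun_eq_chargePotential hn h₁ h₂ hd hx, fun x hx => ?_⟩
  rw [← lap_chargePotential (by omega) ha hK hp hx]
  refine Finset.sum_congr rfl fun i _ => ?_
  have h := (hFun_eventuallyEq hn h₁ h₂ hd hx).fderiv (𝕜 := ℝ)
  exact congrArg (fun L : ES n →L[ℝ] ℝ => L (EuclideanSpace.single i 1)) (EventuallyEq.fderiv_eq
    (h.fun_comp fun L : ES n →L[ℝ] ℝ => L (EuclideanSpace.single i 1)))

theorem tsum_totalCharge (hn : 3 ≤ n) (h₁ : 0 < r₁) (h₂ : 0 < r₂) (hd : r₁ + r₂ < dist c₁ c₂) :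
    ∑' i, totalCharge c₁ c₂ r₁ r₂ i = 0 := by
  have hQ : ∀ {c₁ c₂ : ES n} {r₁ r₂ : ℝ},
      ∑' m, imageCharge c₁ c₂ r₁ r₂ m = QSum n c₁ c₂ r₁ r₂ := rfl
  rw [tsum_sum_type (summable_abs_totalCharge hn h₁ h₂ hd).of_abs]
  simp only [Function.comp_apply, totalCharge, Sum.elim_inl, Sum.elim_inr, tsum_mul_left, hQ]
  ring

theorem hFun_isBigO (hn : 3 ≤ n) (h₁ : 0 < r₁) (h₂ : 0 < r₂) (hd : r₁ + r₂ < dist c₁ c₂) :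
    hFun n c₁ c₂ r₁ r₂ =O[Bornology.cobounded (ES n)] fun x => ‖x‖ ^ (1 - (n : ℝ)) := by
  have hK := (isCompact_imageBall (c₁ := c₁) (c₂ := c₂) (r₁ := r₁) (r₂ := r₂)).union
    (isCompact_imageBall (c₁ := c₂) (c₂ := c₁) (r₁ := r₂) (r₂ := r₁))
  refine (chargePotential_sub_isBigO (by omega) (summable_abs_totalCharge hn h₁ h₂ hd) hK
    (totalPosition_mem h₁ h₂ hd)).congr' ?_ EventuallyEq.rfl
  filter_upwards [show (imageBall c₁ c₂ r₁ r₂ ∪ imageBall c₂ c₁ r₂ r₁)ᶜ ∈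
    Bornology.cobounded (ES n) from hK.isBounded] with x hx
  rw [tsum_totalCharge hn h₁ h₂ hd, zero_mul, sub_zero, hFun_eq_chargePotential hn h₁ h₂ hd hx]

theorem tsum_ite_dist_center_lt (hn : 3 ≤ n) (h₁ : 0 < r₁) (h₂ : 0 < r₂)
    (hd : r₁ + r₂ < dist c₁ c₂) :
    ∑' i, (if dist (totalPosition c₁ c₂ r₁ r₂ i) c₁ < r₁ then totalCharge c₁ c₂ r₁ r₂ i else 0) =
      1 / ((2 - (n : ℝ)) * sphereArea n) := by
  have hd' : r₂ + r₁ < dist c₂ c₁ := by rwa [add_comm, dist_comm]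
  have hin : ∀ {y : ES n}, y ∈ imageBall c₁ c₂ r₁ r₂ → dist y c₁ < r₁ := fun hy =>
    imageBall_subset_ball h₁ hd hy
  have hout : ∀ {y : ES n}, y ∈ imageBall c₂ c₁ r₂ r₁ → ¬ dist y c₁ < r₁ := by
    intro y hy
    have := sub_le_dist_of_mem_ball (c₁ := c₁) (imageBall_subset_ball h₂ hd' hy)
    rw [dist_comm y]
    linarith
  have hs : Summable fun i =>
      if dist (totalPosition c₁ c₂ r₁ r₂ i) c₁ < r₁ then totalCharge c₁ c₂ r₁ r₂ i else 0 := by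
    refine (summable_abs_totalCharge hn h₁ h₂ hd).of_norm_bounded fun i => ?_
    split_ifs <;> simp
  have hM := (MSum_pos hn h₁ h₂ hd).ne'
  rw [tsum_sum_type hs, tsum_eq_even_add_odd (hs.comp_injective Sum.inl_injective),
    tsum_eq_even_add_odd (hs.comp_injective Sum.inr_injective)]
  simp only [Function.comp_apply, totalPosition, totalCharge, Sum.elim_inl, Sum.elim_inr,
    hin (cSeq_two_mul_mem h₁ h₂ hd _), hout (cSeq_two_mul_add_one_mem h₁ h₂ hd _),
    hout (cSeq_two_mul_mem h₂ h₁ hd' _), hin (cSeq_two_mul_add_one_mem h₂ h₁ hd' _), if_true,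
    if_false, tsum_zero, imageCharge_two_mul, imageCharge_two_mul_add_one, tsum_mul_left, tsum_neg]
  rw [← div_self hM]
  nth_rw 3 [MSum]
  field_simp
  ring

theorem flux_hFun (hn : 3 ≤ n) (h₁ : 0 < r₁) (h₂ : 0 < r₂) (hd : r₁ + r₂ < dist c₁ c₂) :
    flux (hFun n c₁ c₂ r₁ r₂) c₁ r₁ = 1 := by
  have hS := disjoint_sphere_imageBalls h₁ h₂ hd
  have hcongr : flux (hFun n c₁ c₂ r₁ r₂) c₁ r₁ = flux (chargePotential n
      (totalCharge c₁ c₂ r₁ r₂) (totalPosition c₁ c₂ r₁ r₂)) c₁ r₁ := by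
    rw [flux_eq_setIntegral_fderiv, flux_eq_setIntegral_fderiv]
    refine setIntegral_congr_fun isClosed_sphere.measurableSet fun x hx => ?_
    rw [(hFun_eventuallyEq hn h₁ h₂ hd (Set.disjoint_left.1 hS hx)).fderiv_eq]
  rw [hcongr, flux_chargePotential (by omega) (summable_abs_totalCharge hn h₁ h₂ hd)
    (isCompact_imageBall.union isCompact_imageBall) (totalPosition_mem h₁ h₂ hd) h₁ hS,
    tsum_ite_dist_center_lt hn h₁ h₂ hd]
  have hω : sphereArea n ≠ 0 := (sphereArea_pos (by omega)).ne'
  have hn2 : (2 : ℝ) - n ≠ 0 := by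
    have : (3 : ℝ) ≤ n := by exact_mod_cast hn
    linarith
  field_simp

theorem flux_neg (u : ES n → ℝ) (c : ES n) (r : ℝ) : flux (-u) c r = -flux u c r := by
  simp only [flux_eq_setIntegral_fderiv, fderiv_neg, neg_apply, integral_neg]

theorem summable_qSeq_pow_div (hn : 3 ≤ n) (h₁ : 0 < r₁) (h₂ : 0 < r₂)
    (hd : r₁ + r₂ < dist c₁ c₂) {x : ES n}
    (hx : x ∉ imageBall c₁ c₂ r₁ r₂ ∪ imageBall c₂ c₁ r₂ r₁) :
    Summable fun m => qSeq c₁ c₂ r₁ r₂ m ^ (n - 2) / ‖x - cSeq c₁ c₂ r₁ r₂ m‖ ^ (n - 2) := by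
  refine (summable_mul_pointPotential (summable_abs_imageCharge hn h₁ h₂ hd)
    (isCompact_imageBall.union isCompact_imageBall) (cSeq_mem h₁ h₂ hd) hx).abs.congr fun m => ?_
  rw [abs_mul, abs_imageCharge h₁ h₂ hd, pointPotential, div_eq_mul_inv,
    abs_of_nonneg (inv_nonneg.2 (by positivity))]

end Images

/-- **Lemma 4.1: the series defines the solution of the dual problem.**
For `n ≥ 3`, the function `h` defined by the weighted series of point-charge potentials is
well defined (the series converge absolutely outside the two closed balls), is harmonic
there, decays like `|x|^{1−n}`, is constant on each boundary sphere, and has outward flux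
`1` through `∂D₁` and `−1` through `∂D₂`. -/
theorem hFun_solves_dual_problem
    (n : ℕ) (hn : 3 ≤ n) (r₁ r₂ ε : ℝ) (hr₁ : 0 < r₁) (hr₂ : 0 < r₂) (hε : 0 < ε) :
    (∀ x ∈ (closedBall (EuclideanSpace.single (⟨0, by omega⟩ : Fin n) (r₁ + ε) : ES n) r₁ ∪
        closedBall (EuclideanSpace.single (⟨0, by omega⟩ : Fin n) (-(r₂ + ε)) : ES n) r₂)ᶜ,
      Summable (fun m : ℕ =>
        qSeq (EuclideanSpace.single (⟨0, by omega⟩ : Fin n) (r₁ + ε))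
            (EuclideanSpace.single (⟨0, by omega⟩ : Fin n) (-(r₂ + ε))) r₁ r₂ m ^ (n - 2) /
          ‖x - cSeq (EuclideanSpace.single (⟨0, by omega⟩ : Fin n) (r₁ + ε))
              (EuclideanSpace.single (⟨0, by omega⟩ : Fin n) (-(r₂ + ε))) r₁ r₂ m‖ ^ (n - 2)) ∧
      Summable (fun m : ℕ =>
        qSeq (EuclideanSpace.single (⟨0, by omega⟩ : Fin n) (-(r₂ + ε)))
            (EuclideanSpace.single (⟨0, by omega⟩ : Fin n) (r₁ + ε)) r₂ r₁ m ^ (n - 2) /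
          ‖x - cSeq (EuclideanSpace.single (⟨0, by omega⟩ : Fin n) (-(r₂ + ε)))
              (EuclideanSpace.single (⟨0, by omega⟩ : Fin n) (r₁ + ε)) r₂ r₁ m‖ ^ (n - 2))) ∧
    HarmOn
      (hFun n (EuclideanSpace.single (⟨0, by omega⟩ : Fin n) (r₁ + ε))
        (EuclideanSpace.single (⟨0, by omega⟩ : Fin n) (-(r₂ + ε))) r₁ r₂)
      (closedBall (EuclideanSpace.single (⟨0, by omega⟩ : Fin n) (r₁ + ε) : ES n) r₁ ∪
        closedBall (EuclideanSpace.single (⟨0, by omega⟩ : Fin n) (-(r₂ + ε)) : ES n) r₂)ᶜ ∧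
    ((hFun n (EuclideanSpace.single (⟨0, by omega⟩ : Fin n) (r₁ + ε))
        (EuclideanSpace.single (⟨0, by omega⟩ : Fin n) (-(r₂ + ε))) r₁ r₂)
      =O[Bornology.cobounded (ES n)] fun x => ‖x‖ ^ (1 - (n : ℝ))) ∧
    (∃ k₁ : ℝ, ∀ x ∈ sphere (EuclideanSpace.single (⟨0, by omega⟩ : Fin n) (r₁ + ε) : ES n) r₁,
      hFun n (EuclideanSpace.single (⟨0, by omega⟩ : Fin n) (r₁ + ε))
        (EuclideanSpace.single (⟨0, by omega⟩ : Fin n) (-(r₂ + ε))) r₁ r₂ x = k₁) ∧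
    (∃ k₂ : ℝ, ∀ x ∈ sphere (EuclideanSpace.single (⟨0, by omega⟩ : Fin n) (-(r₂ + ε)) : ES n) r₂,
      hFun n (EuclideanSpace.single (⟨0, by omega⟩ : Fin n) (r₁ + ε))
        (EuclideanSpace.single (⟨0, by omega⟩ : Fin n) (-(r₂ + ε))) r₁ r₂ x = k₂) ∧
    flux (hFun n (EuclideanSpace.single (⟨0, by omega⟩ : Fin n) (r₁ + ε))
        (EuclideanSpace.single (⟨0, by omega⟩ : Fin n) (-(r₂ + ε))) r₁ r₂)
      (EuclideanSpace.single (⟨0, by omega⟩ : Fin n) (r₁ + ε)) r₁ = 1 ∧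
    flux (hFun n (EuclideanSpace.single (⟨0, by omega⟩ : Fin n) (r₁ + ε))
        (EuclideanSpace.single (⟨0, by omega⟩ : Fin n) (-(r₂ + ε))) r₁ r₂)
      (EuclideanSpace.single (⟨0, by omega⟩ : Fin n) (-(r₂ + ε))) r₂ = -1 := by
  have hd : r₁ + r₂ < dist (EuclideanSpace.single (⟨0, by omega⟩ : Fin n) (r₁ + ε) : ES n)
      (EuclideanSpace.single (⟨0, by omega⟩ : Fin n) (-(r₂ + ε))) := by
    rw [PiLp.dist_single_same, Real.dist_eq, abs_of_pos (by linarith)]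
    linarith
  generalize (EuclideanSpace.single (⟨0, by omega⟩ : Fin n) (r₁ + ε) : ES n) = c₁ at hd ⊢
  generalize (EuclideanSpace.single (⟨0, by omega⟩ : Fin n) (-(r₂ + ε)) : ES n) = c₂ at hd ⊢
  have hd' : r₂ + r₁ < dist c₂ c₁ := by rwa [add_comm, dist_comm]
  have hsub : imageBall c₁ c₂ r₁ r₂ ∪ imageBall c₂ c₁ r₂ r₁ ⊆
      closedBall c₁ r₁ ∪ closedBall c₂ r₂ :=
    Set.union_subset_union ((imageBall_subset_ball hr₁ hd).trans ball_subset_closedBall)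
      ((imageBall_subset_ball hr₂ hd').trans ball_subset_closedBall)
  have hharm := harmOn_hFun hn hr₁ hr₂ hd
  refine ⟨fun x hx => ⟨summable_qSeq_pow_div hn hr₁ hr₂ hd fun h => hx (hsub h),
    summable_qSeq_pow_div hn hr₂ hr₁ hd' fun h => hx (hsub (Set.union_comm _ _ ▸ h))⟩,
    ⟨hharm.1.mono (Set.compl_subset_compl.2 hsub), fun x hx => hharm.2 x fun h => hx (hsub h)⟩,
    hFun_isBigO hn hr₁ hr₂ hd, ⟨_, fun x hx => hFun_eq_of_mem_sphere hn hr₁ hr₂ hd hx⟩,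
    ⟨_, fun x hx => (congrFun (hFun_swap hn hr₂ hr₁ hd') x).trans
      (congrArg Neg.neg (hFun_eq_of_mem_sphere hn hr₂ hr₁ hd' hx))⟩,
    flux_hFun hn hr₁ hr₂ hd, ?_⟩
  rw [hFun_swap hn hr₂ hr₁ hd', flux_neg, flux_hFun hn hr₂ hr₁ hd']
end
end

section
/- Let n = 3, and for s = 1, 2 let c_{s,m} denote the x1-coordinate of the point c_{s,m}. There exists a constant C > 0, independent of r1, r2 and ε, such that for all r1, r2 > 0 and all sufficiently small ε > 0: (1/C)·r1 ≤ Σ_{k=0}^{∞} c_{1,2k}·q_{1,2k} − Σ_{k=0}^{∞} c_{1,2k+1}·q_{1,2k+1} ≤ C·r1, and (1/C)·r2 ≤ −( Σ_{k=0}^{∞} c_{2,2k}·q_{2,2k} − Σ_{k=0}^{∞} c_{2,2k+1}·q_{2,2k+1} ) ≤ C·r2. -/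
open MeasureTheory Metric Filter Asymptotics
open scoped RealInnerProductSpace Topology

noncomputable section

/-- The radius of the ball in which the `m`-th reflection takes place. -/
def stepRadius (r₁ r₂ : ℝ) (m : ℕ) : ℝ := if m % 2 = 0 then r₂ else r₁

/-- The distances `|c_{1,m}| + ε` of the reflected centers from the origin, shifted by `ε`. -/
def shiftedDist (r₁ r₂ ε : ℝ) : ℕ → ℝ
  | 0 => r₁ + 2 * ε
  | m + 1 => 2 * ε + stepRadius r₁ r₂ m * shiftedDist r₁ r₂ ε m /
      (shiftedDist r₁ r₂ ε m + stepRadius r₁ r₂ m)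

section

variable {r₁ r₂ ε : ℝ}

lemma stepRadius_pos (h₁ : 0 < r₁) (h₂ : 0 < r₂) (m : ℕ) : 0 < stepRadius r₁ r₂ m := by
  unfold stepRadius; split_ifs <;> assumption

lemma two_mul_le_shiftedDist (h₁ : 0 < r₁) (h₂ : 0 < r₂) (hε : 0 < ε) (m : ℕ) :
    2 * ε ≤ shiftedDist r₁ r₂ ε m := by
  induction m with
  | zero => simp only [shiftedDist]; linarith
  | succ m ih =>
    have hs := stepRadius_pos h₁ h₂ m
    have hb : 0 < shiftedDist r₁ r₂ ε m := by linarith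
    have : 0 ≤ stepRadius r₁ r₂ m * shiftedDist r₁ r₂ ε m /
      (shiftedDist r₁ r₂ ε m + stepRadius r₁ r₂ m) := by positivity
    simp only [shiftedDist]; linarith

lemma shiftedDist_pos (h₁ : 0 < r₁) (h₂ : 0 < r₂) (hε : 0 < ε) (m : ℕ) :
    0 < shiftedDist r₁ r₂ ε m := by
  linarith [two_mul_le_shiftedDist h₁ h₂ hε m]

lemma shiftedDist_succ_le (h₁ : 0 < r₁) (h₂ : 0 < r₂) (hε : 0 < ε) (m : ℕ) :
    shiftedDist r₁ r₂ ε (m + 1) ≤ 2 * ε + shiftedDist r₁ r₂ ε m := by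
  have hs := stepRadius_pos h₁ h₂ m
  have hb := shiftedDist_pos h₁ h₂ hε m
  simp only [shiftedDist]
  gcongr
  rw [div_le_iff₀ (by positivity)]
  nlinarith

lemma shiftedDist_succ_le_radius (h₁ : 0 < r₁) (h₂ : 0 < r₂) (hε : 0 < ε) (m : ℕ) :
    shiftedDist r₁ r₂ ε (m + 1) ≤ 2 * ε + stepRadius r₁ r₂ m := by
  have hs := stepRadius_pos h₁ h₂ m
  have hb := shiftedDist_pos h₁ h₂ hε m
  simp only [shiftedDist]
  gcongr
  rw [div_le_iff₀ (by positivity)]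
  nlinarith

lemma shiftedDist_even_le (h₁ : 0 < r₁) (h₂ : 0 < r₂) (hε : 0 < ε) (k : ℕ) :
    shiftedDist r₁ r₂ ε (2 * k) ≤ r₁ + 2 * ε := by
  cases k with
  | zero => simp [shiftedDist]
  | succ k =>
    have h := shiftedDist_succ_le_radius h₁ h₂ hε (2 * k + 1)
    have hs : stepRadius r₁ r₂ (2 * k + 1) = r₁ := by
      unfold stepRadius; rw [if_neg (by omega)]
    rw [hs] at h
    rw [show 2 * (k + 1) = 2 * k + 1 + 1 by ring]
    linarith

/-- The reflected centers alternate between the two half-axes. -/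
lemma cSeq_eq_single (h₁ : 0 < r₁) (h₂ : 0 < r₂) (hε : 0 < ε) {σ x y : ℝ}
    (hσ : |σ| = 1) (hx : x = σ * (r₁ + ε)) (hy : y = -σ * (r₂ + ε)) (m : ℕ) :
    cSeq (EuclideanSpace.single 0 x : ES 3) (EuclideanSpace.single 0 y) r₁ r₂ m =
      EuclideanSpace.single 0 (σ * (-1) ^ m * (shiftedDist r₁ r₂ ε m - ε)) := by
  induction m with
  | zero => simp only [cSeq, shiftedDist, hx]; congr 1; ring
  | succ m ih =>
    have hb := shiftedDist_pos h₁ h₂ hε m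
    have hσ2 : σ ^ 2 = 1 := by rw [← sq_abs, hσ, one_pow]
    have key : ∀ s b : ℝ, 0 < s → 0 < b → ∀ τ : ℝ, τ ^ 2 = 1 →
        reflBall (EuclideanSpace.single 0 (-τ * (s + ε)) : ES 3) s
          (EuclideanSpace.single 0 (τ * (b - ε))) =
        EuclideanSpace.single 0 (-τ * (2 * ε + s * b / (b + s) - ε)) := by
      intro s b hs hb τ hτ
      have hsub : (EuclideanSpace.single 0 (τ * (b - ε)) : ES 3) -
          EuclideanSpace.single 0 (-τ * (s + ε)) =
          EuclideanSpace.single 0 (τ * (b + s)) := by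
        rw [← PiLp.single_sub]; congr 1; ring
      unfold reflBall
      rw [hsub, PiLp.norm_single, Real.norm_eq_abs, sq_abs, mul_pow, hτ, one_mul]
      ext i
      fin_cases i <;> simp
      field_simp
      ring
    simp only [cSeq, shiftedDist, ih]
    rcases Nat.even_or_odd m with he | ho
    · have hm : m % 2 = 0 := Nat.even_iff.mp he
      have := key r₂ (shiftedDist r₁ r₂ ε m) h₂ hb σ hσ2
      rw [if_pos hm, he.neg_one_pow, pow_succ, he.neg_one_pow, hy, mul_one, this]
      simp [stepRadius, hm]
    · have hm : ¬ m % 2 = 0 := by rw [Nat.odd_iff.mp ho]; norm_num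
      have := key r₁ (shiftedDist r₁ r₂ ε m) h₁ hb (-σ) (by rw [neg_sq, hσ2])
      rw [neg_neg] at this
      rw [if_neg hm, ho.neg_one_pow, pow_succ, ho.neg_one_pow, hx, mul_neg_one, this]
      simp [stepRadius, hm]

lemma rhoSeq_succ_eq (h₁ : 0 < r₁) (h₂ : 0 < r₂) (hε : 0 < ε) {σ x y : ℝ}
    (hσ : |σ| = 1) (hx : x = σ * (r₁ + ε)) (hy : y = -σ * (r₂ + ε)) (m : ℕ) :
    rhoSeq (EuclideanSpace.single 0 x : ES 3) (EuclideanSpace.single 0 y) r₁ r₂ (m + 1) =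
      stepRadius r₁ r₂ m / (shiftedDist r₁ r₂ ε m + stepRadius r₁ r₂ m) := by
  have hb := shiftedDist_pos h₁ h₂ hε m
  simp only [rhoSeq, cSeq_eq_single h₁ h₂ hε hσ hx hy m, ← PiLp.single_sub,
    PiLp.norm_single, Real.norm_eq_abs]
  rcases Nat.even_or_odd m with he | ho
  · have hm : m % 2 = 0 := Nat.even_iff.mp he
    simp only [hm, if_true, stepRadius, he.neg_one_pow, hy]
    rw [show -σ * (r₂ + ε) - σ * 1 * (shiftedDist r₁ r₂ ε m - ε) =
      -(σ * (shiftedDist r₁ r₂ ε m + r₂)) by ring, abs_neg, abs_mul, hσ, one_mul,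
      abs_of_pos (by positivity)]
  · have hm : ¬ m % 2 = 0 := by rw [Nat.odd_iff.mp ho]; norm_num
    simp only [hm, if_false, stepRadius, ho.neg_one_pow, hx]
    rw [show σ * (r₁ + ε) - σ * -1 * (shiftedDist r₁ r₂ ε m - ε) =
      σ * (shiftedDist r₁ r₂ ε m + r₁) by ring, abs_mul, hσ, one_mul,
      abs_of_pos (by positivity)]

/-- The sum of all `|c_{1,m}| q_{1,m}`, split into even and odd `m`, is of order `r₁`. -/
lemma shiftedDist_sum_estimates (h₁ : 0 < r₁) (h₂ : 0 < r₂) (hε : 0 < ε) (hε₁ : 4 * ε ≤ r₁)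
    {q : ℕ → ℝ} (hq₀ : q 0 = 1) (hq : ∀ m, q (m + 1) =
      q m * (stepRadius r₁ r₂ m / (shiftedDist r₁ r₂ ε m + stepRadius r₁ r₂ m))) :
    r₁ ≤ (∑' k, (shiftedDist r₁ r₂ ε (2 * k) - ε) * q (2 * k)) +
        ∑' k, (shiftedDist r₁ r₂ ε (2 * k + 1) - ε) * q (2 * k + 1) ∧
      (∑' k, (shiftedDist r₁ r₂ ε (2 * k) - ε) * q (2 * k)) +
        ∑' k, (shiftedDist r₁ r₂ ε (2 * k + 1) - ε) * q (2 * k + 1) ≤ 11 * r₁ := by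
  have hb := shiftedDist_pos h₁ h₂ hε
  have hb2 := two_mul_le_shiftedDist h₁ h₂ hε
  have hs := stepRadius_pos h₁ h₂
  have hqpos : ∀ m, 0 < q m := by
    intro m
    induction m with
    | zero => rw [hq₀]; norm_num
    | succ m ih => rw [hq]; have := hb m; have := hs m; positivity
  have hdiff : ∀ m, q m * shiftedDist r₁ r₂ ε m =
      (shiftedDist r₁ r₂ ε m + stepRadius r₁ r₂ m) * (q m - q (m + 1)) := by
    intro m
    have := hb m
    have := hs m
    rw [hq]; field_simp; ring
  have hanti : ∀ m, q (m + 1) ≤ q m := by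
    intro m
    have h := hdiff m
    have hp := mul_pos (hqpos m) (hb m)
    rw [h] at hp
    have := pos_of_mul_pos_right hp (add_pos (hb m) (hs m)).le
    linarith
  have hodd : ∀ k, shiftedDist r₁ r₂ ε (2 * k + 1) * q (2 * k + 1) ≤
      3 * r₁ * (q (2 * k + 1) - q (2 * k + 1 + 1)) := by
    intro k
    have hsr : stepRadius r₁ r₂ (2 * k + 1) = r₁ := by
      unfold stepRadius; rw [if_neg (by omega)]
    rw [mul_comm, hdiff, hsr]
    have := shiftedDist_succ_le h₁ h₂ hε (2 * k)
    have := shiftedDist_even_le h₁ h₂ hε k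
    apply mul_le_mul_of_nonneg_right _ (sub_nonneg.2 (hanti _))
    linarith
  have hoddsum : ∀ N, ∑ k ∈ Finset.range N, shiftedDist r₁ r₂ ε (2 * k + 1) * q (2 * k + 1) ≤
      3 * r₁ * (1 - q (2 * N)) := by
    intro N
    induction N with
    | zero => simp [hq₀]
    | succ N ih =>
      rw [Finset.sum_range_succ, show 2 * (N + 1) = 2 * N + 1 + 1 by ring]
      nlinarith [hodd N, hanti (2 * N)]
  have hoddbd : ∀ N, ∑ k ∈ Finset.range N, shiftedDist r₁ r₂ ε (2 * k + 1) * q (2 * k + 1) ≤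
      3 * r₁ := by
    intro N
    nlinarith [hoddsum N, hqpos (2 * N)]
  have heven : ∀ k, shiftedDist r₁ r₂ ε (2 * (k + 1)) * q (2 * (k + 1)) ≤
      2 * (shiftedDist r₁ r₂ ε (2 * k + 1) * q (2 * k + 1)) := by
    intro k
    rw [show 2 * (k + 1) = 2 * k + 1 + 1 by ring, ← mul_assoc]
    have := shiftedDist_succ_le h₁ h₂ hε (2 * k + 1)
    have := hb2 (2 * k + 1)
    exact mul_le_mul (by linarith) (hanti _) (hqpos _).le (by linarith [hb (2 * k + 1)])
  have hevenbd : ∀ N, ∑ k ∈ Finset.range N, shiftedDist r₁ r₂ ε (2 * k) * q (2 * k) ≤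
      8 * r₁ := by
    intro N
    cases N with
    | zero => simp [h₁.le]
    | succ N =>
      rw [Finset.sum_range_succ']
      have hle : ∑ k ∈ Finset.range N, shiftedDist r₁ r₂ ε (2 * (k + 1)) * q (2 * (k + 1)) ≤
          2 * ∑ k ∈ Finset.range N, shiftedDist r₁ r₂ ε (2 * k + 1) * q (2 * k + 1) := by
        rw [Finset.mul_sum]
        exact Finset.sum_le_sum fun k _ => heven k
      have := hoddbd N
      simp only [mul_zero, hq₀, shiftedDist]
      linarith
  have hnn : ∀ m, 0 ≤ (shiftedDist r₁ r₂ ε m - ε) * q m := fun m =>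
    mul_nonneg (by linarith [hb2 m]) (hqpos m).le
  have hle : ∀ m, (shiftedDist r₁ r₂ ε m - ε) * q m ≤ shiftedDist r₁ r₂ ε m * q m := fun m =>
    mul_le_mul_of_nonneg_right (by linarith) (hqpos m).le
  have hE : ∀ N, ∑ k ∈ Finset.range N, (shiftedDist r₁ r₂ ε (2 * k) - ε) * q (2 * k) ≤
      8 * r₁ := fun N => (Finset.sum_le_sum fun k _ => hle (2 * k)).trans (hevenbd N)
  have hO : ∀ N, ∑ k ∈ Finset.range N,
      (shiftedDist r₁ r₂ ε (2 * k + 1) - ε) * q (2 * k + 1) ≤ 3 * r₁ := fun N =>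
    (Finset.sum_le_sum fun k _ => hle (2 * k + 1)).trans (hoddbd N)
  have hEs := summable_of_sum_range_le (fun k => hnn (2 * k)) hE
  have hE0 := hEs.le_tsum 0 fun k _ => hnn (2 * k)
  have hO0 : 0 ≤ ∑' k, (shiftedDist r₁ r₂ ε (2 * k + 1) - ε) * q (2 * k + 1) :=
    tsum_nonneg fun k => hnn (2 * k + 1)
  have hEt := Real.tsum_le_of_sum_range_le (fun k => hnn (2 * k)) hE
  have hOt := Real.tsum_le_of_sum_range_le (fun k => hnn (2 * k + 1)) hO
  simp only [mul_zero, hq₀, shiftedDist] at hE0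
  constructor <;> linarith

lemma cSeq_mul_qSeq_sum_estimates (h₁ : 0 < r₁) (h₂ : 0 < r₂) (hε : 0 < ε) (hε₁ : 4 * ε ≤ r₁)
    {σ x y : ℝ} (hσ : |σ| = 1) (hx : x = σ * (r₁ + ε)) (hy : y = -σ * (r₂ + ε)) :
    r₁ ≤ σ * ((∑' k : ℕ, (cSeq (EuclideanSpace.single 0 x : ES 3)
            (EuclideanSpace.single 0 y) r₁ r₂ (2 * k)) 0 *
          qSeq (EuclideanSpace.single 0 x : ES 3) (EuclideanSpace.single 0 y) r₁ r₂ (2 * k)) -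
        ∑' k : ℕ, (cSeq (EuclideanSpace.single 0 x : ES 3)
            (EuclideanSpace.single 0 y) r₁ r₂ (2 * k + 1)) 0 *
          qSeq (EuclideanSpace.single 0 x : ES 3)
            (EuclideanSpace.single 0 y) r₁ r₂ (2 * k + 1)) ∧
      σ * ((∑' k : ℕ, (cSeq (EuclideanSpace.single 0 x : ES 3)
            (EuclideanSpace.single 0 y) r₁ r₂ (2 * k)) 0 *
          qSeq (EuclideanSpace.single 0 x : ES 3) (EuclideanSpace.single 0 y) r₁ r₂ (2 * k)) -
        ∑' k : ℕ, (cSeq (EuclideanSpace.single 0 x : ES 3)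
            (EuclideanSpace.single 0 y) r₁ r₂ (2 * k + 1)) 0 *
          qSeq (EuclideanSpace.single 0 x : ES 3)
            (EuclideanSpace.single 0 y) r₁ r₂ (2 * k + 1)) ≤ 11 * r₁ := by
  have hσ2 : σ * σ = 1 := by rw [← abs_mul_abs_self, hσ, one_mul]
  have key := shiftedDist_sum_estimates h₁ h₂ hε hε₁
    (q := qSeq (EuclideanSpace.single 0 x : ES 3) (EuclideanSpace.single 0 y) r₁ r₂)
    (by simp [qSeq, rhoSeq])
    (fun m => by rw [qSeq, Finset.prod_range_succ, rhoSeq_succ_eq h₁ h₂ hε hσ hx hy]; rfl)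
  have hev : ∀ k : ℕ, (-1 : ℝ) ^ (2 * k) = 1 := fun k => (even_two_mul k).neg_one_pow
  have hod : ∀ k : ℕ, (-1 : ℝ) ^ (2 * k + 1) = -1 := fun k => (odd_two_mul_add_one k).neg_one_pow
  simp only [cSeq_eq_single h₁ h₂ hε hσ hx hy, PiLp.single_apply, if_true, hev, hod, mul_assoc,
    tsum_mul_left, one_mul]
  rw [← mul_sub, ← mul_assoc, hσ2, one_mul, neg_one_mul, sub_neg_eq_add]
  exact key

end

/-- **Lemma 4.2 (part 2), `n = 3`: estimates for the weighted sums of the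
`x₁`-coordinates `c_{s,m}` of the reflected centers.**
There is `C > 0`, independent of `r₁`, `r₂`, `ε`, such that for all `r₁, r₂ > 0` and
all sufficiently small `ε > 0`:
`r₁/C ≤ Σ_k c_{1,2k}q_{1,2k} − Σ_k c_{1,2k+1}q_{1,2k+1} ≤ C·r₁` and
`r₂/C ≤ −(Σ_k c_{2,2k}q_{2,2k} − Σ_k c_{2,2k+1}q_{2,2k+1}) ≤ C·r₂`. -/
theorem cq_sum_estimates_dim3 :
    ∃ C : ℝ, 0 < C ∧
      ∀ r₁ r₂ : ℝ, 0 < r₁ → 0 < r₂ → ∃ ε₀ : ℝ, 0 < ε₀ ∧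
        ∀ ε : ℝ, 0 < ε → ε < ε₀ →
          ((1 / C) * r₁ ≤
              (∑' k : ℕ, (cSeq (EuclideanSpace.single 0 (r₁ + ε) : ES 3)
                    (EuclideanSpace.single 0 (-(r₂ + ε))) r₁ r₂ (2 * k)) 0 *
                  qSeq (EuclideanSpace.single 0 (r₁ + ε) : ES 3)
                    (EuclideanSpace.single 0 (-(r₂ + ε))) r₁ r₂ (2 * k)) -
                (∑' k : ℕ, (cSeq (EuclideanSpace.single 0 (r₁ + ε) : ES 3)
                    (EuclideanSpace.single 0 (-(r₂ + ε))) r₁ r₂ (2 * k + 1)) 0 *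
                  qSeq (EuclideanSpace.single 0 (r₁ + ε) : ES 3)
                    (EuclideanSpace.single 0 (-(r₂ + ε))) r₁ r₂ (2 * k + 1)) ∧
            (∑' k : ℕ, (cSeq (EuclideanSpace.single 0 (r₁ + ε) : ES 3)
                  (EuclideanSpace.single 0 (-(r₂ + ε))) r₁ r₂ (2 * k)) 0 *
                qSeq (EuclideanSpace.single 0 (r₁ + ε) : ES 3)
                  (EuclideanSpace.single 0 (-(r₂ + ε))) r₁ r₂ (2 * k)) -
              (∑' k : ℕ, (cSeq (EuclideanSpace.single 0 (r₁ + ε) : ES 3)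
                  (EuclideanSpace.single 0 (-(r₂ + ε))) r₁ r₂ (2 * k + 1)) 0 *
                qSeq (EuclideanSpace.single 0 (r₁ + ε) : ES 3)
                  (EuclideanSpace.single 0 (-(r₂ + ε))) r₁ r₂ (2 * k + 1)) ≤ C * r₁) ∧
          ((1 / C) * r₂ ≤
              -((∑' k : ℕ, (cSeq (EuclideanSpace.single 0 (-(r₂ + ε)) : ES 3)
                    (EuclideanSpace.single 0 (r₁ + ε)) r₂ r₁ (2 * k)) 0 *
                  qSeq (EuclideanSpace.single 0 (-(r₂ + ε)) : ES 3)
                    (EuclideanSpace.single 0 (r₁ + ε)) r₂ r₁ (2 * k)) -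
                (∑' k : ℕ, (cSeq (EuclideanSpace.single 0 (-(r₂ + ε)) : ES 3)
                    (EuclideanSpace.single 0 (r₁ + ε)) r₂ r₁ (2 * k + 1)) 0 *
                  qSeq (EuclideanSpace.single 0 (-(r₂ + ε)) : ES 3)
                    (EuclideanSpace.single 0 (r₁ + ε)) r₂ r₁ (2 * k + 1))) ∧
            -((∑' k : ℕ, (cSeq (EuclideanSpace.single 0 (-(r₂ + ε)) : ES 3)
                  (EuclideanSpace.single 0 (r₁ + ε)) r₂ r₁ (2 * k)) 0 *
                qSeq (EuclideanSpace.single 0 (-(r₂ + ε)) : ES 3)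
                  (EuclideanSpace.single 0 (r₁ + ε)) r₂ r₁ (2 * k)) -
              (∑' k : ℕ, (cSeq (EuclideanSpace.single 0 (-(r₂ + ε)) : ES 3)
                  (EuclideanSpace.single 0 (r₁ + ε)) r₂ r₁ (2 * k + 1)) 0 *
                qSeq (EuclideanSpace.single 0 (-(r₂ + ε)) : ES 3)
                  (EuclideanSpace.single 0 (r₁ + ε)) r₂ r₁ (2 * k + 1))) ≤ C * r₂) := by
  refine ⟨11, by norm_num, fun r₁ r₂ h₁ h₂ => ⟨min r₁ r₂ / 4, by positivity, fun ε hε hlt => ?_⟩⟩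
  have hε₁ : 4 * ε ≤ r₁ := by linarith [min_le_left r₁ r₂]
  have hε₂ : 4 * ε ≤ r₂ := by linarith [min_le_right r₁ r₂]
  have A := cSeq_mul_qSeq_sum_estimates h₁ h₂ hε hε₁ (σ := 1) (x := r₁ + ε) (y := -(r₂ + ε))
    (by simp) (by ring) (by ring)
  have B := cSeq_mul_qSeq_sum_estimates h₂ h₁ hε hε₂ (σ := -1) (x := -(r₂ + ε)) (y := r₁ + ε)
    (by simp) (by ring) (by ring)
  rw [one_mul] at A
  rw [neg_one_mul] at B
  exact ⟨⟨by linarith [A.1], A.2⟩, by linarith [B.1], B.2⟩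
end
end

section
/- Let n ≥ 3, let 0 < d ≤ 1 and δ > 0, and in ℝⁿ let D̃1 = B_1((1+δ, 0, …, 0)), D̃2 = B_d((−d−δ, 0, …, 0)), Ω = B_4(0). Let ρ be the function continuous on cl Ω ∖ (D̃1∪D̃2) and harmonic in Ω ∖ cl(D̃1∪D̃2) with boundary values ρ = 0 on ∂D̃1 ∪ ∂D̃2 and ρ = 1 on ∂Ω. Then there is a constant C > 0, independent of d and δ, such that for all sufficiently small δ > 0: sup over x ∈ ∂D̃1 ∪ ∂D̃2 of |∇ρ(x)| ≤ C/d (more precisely, |∇ρ| ≤ C on ∂D̃1 and |∇ρ| ≤ C/d on ∂D̃2). -/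
open MeasureTheory Metric Filter Asymptotics
open scoped RealInnerProductSpace Topology

noncomputable section

/-- If `a ≤ b` near `t`, with equality at `t`, then the second derivative of `a` at `t` is at most
that of `b`. -/
lemma second_deriv_le_of_eventually_le {a b a' b' : ℝ → ℝ} {t a₂ b₂ : ℝ}
    (ha : ∀ᶠ s in 𝓝 t, HasDerivAt a (a' s) s) (hb : ∀ᶠ s in 𝓝 t, HasDerivAt b (b' s) s)
    (ha' : HasDerivAt a' a₂ t) (hb' : HasDerivAt b' b₂ t)
    (hle : ∀ᶠ s in 𝓝 t, a s ≤ b s) (heq : a t = b t) : a₂ ≤ b₂ := by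
  by_contra! hlt
  set f : ℝ → ℝ := fun s => a s - b s with hf
  have hd : deriv f =ᶠ[𝓝 t] fun s => a' s - b' s := by
    filter_upwards [ha, hb] with s h₁ h₂
    exact (h₁.sub h₂).deriv
  have hmax : IsLocalMax f t := by
    filter_upwards [hle] with s hs
    simp only [hf]
    linarith
  have hdd : deriv (deriv f) t = a₂ - b₂ := by
    rw [hd.deriv_eq]
    exact (ha'.sub hb').deriv
  have hmin : IsLocalMin f t := by
    refine isLocalMin_of_deriv_deriv_pos (by rw [hdd]; linarith) hmax.deriv_eq_zero ?_
    exact (ha.self_of_nhds.continuousAt).sub hb.self_of_nhds.continuousAt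
  have hconst : f =ᶠ[𝓝 t] fun _ => f t := by
    filter_upwards [hmax, hmin] with s h₁ h₂
    exact le_antisymm h₁ h₂
  have hd0 : deriv f =ᶠ[𝓝 t] fun _ => 0 := by
    filter_upwards [hconst.eventuallyEq_nhds] with s hs
    rw [hs.deriv_eq, deriv_const]
  have : deriv (deriv f) t = 0 := by rw [hd0.deriv_eq, deriv_const]
  linarith

/-- First and second derivatives at `0` of `-(q + 2ps + s²)⁻ᵐ`, the restriction to a line of
`y ↦ -‖y - c‖⁻²ᵐ`. -/
lemma hasDerivAt_deriv_inv_pow_quadratic {p q : ℝ} (m : ℕ) (hq : 0 < q) :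
    (∀ᶠ s in 𝓝 (0 : ℝ), HasDerivAt (fun s : ℝ => -((q + 2 * p * s + s ^ 2) ^ m)⁻¹)
      (m * (2 * p + 2 * s) * ((q + 2 * p * s + s ^ 2) ^ (m + 1))⁻¹) s) ∧
    HasDerivAt (fun s : ℝ => m * (2 * p + 2 * s) * ((q + 2 * p * s + s ^ 2) ^ (m + 1))⁻¹)
      (2 * m * (q - 2 * (m + 1) * p ^ 2) * (q ^ (m + 2))⁻¹) 0 := by
  have hQ : ∀ s : ℝ, HasDerivAt (fun s : ℝ => q + 2 * p * s + s ^ 2) (2 * p + 2 * s) s := by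
    intro s
    have := (((hasDerivAt_id s).const_mul (2 * p)).const_add q).add ((hasDerivAt_id s).pow 2)
    refine this.congr_deriv ?_
    simp
  have hinv : ∀ (k : ℕ) (s : ℝ), q + 2 * p * s + s ^ 2 ≠ 0 →
      HasDerivAt (fun s : ℝ => ((q + 2 * p * s + s ^ 2) ^ k)⁻¹)
        (-(k * (2 * p + 2 * s) * ((q + 2 * p * s + s ^ 2) ^ (k + 1))⁻¹)) s := by
    intro k s hs
    refine (((hQ s).pow k).inv (pow_ne_zero k hs)).congr_deriv ?_
    cases k with
    | zero => simp
    | succ k =>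
      simp only [Nat.add_sub_cancel, Pi.pow_apply]
      field_simp
      ring
  constructor
  · have hc : ContinuousAt (fun s : ℝ => q + 2 * p * s + s ^ 2) 0 := (hQ 0).continuousAt
    have h0 : q + 2 * p * 0 + 0 ^ 2 ≠ 0 := by simpa using hq.ne'
    filter_upwards [hc.eventually_ne h0] with s hs
    exact (hinv m s hs).neg.congr_deriv (neg_neg _)
  · have h1 : HasDerivAt (fun s : ℝ => (m : ℝ) * (2 * p + 2 * s)) (m * 2) 0 := by
      have := (((hasDerivAt_id (0 : ℝ)).const_mul 2).const_add (2 * p)).const_mul (m : ℝ)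
      simpa using this
    refine (h1.mul (hinv (m + 1) 0 (by simpa using hq.ne'))).congr_deriv ?_
    simp only [mul_zero, add_zero, ne_eq, OfNat.ofNat_ne_zero, not_false_eq_true, zero_pow]
    push_cast
    field_simp
    ring

/-- The strictly superharmonic function `2 (1 - (r / ‖y - c‖)²ⁿ)` vanishing on the sphere of
radius `r` centered at `c`. -/
def sphereBarrier {n : ℕ} (c : ES n) (r : ℝ) (y : ES n) : ℝ :=
  2 * (1 - r ^ (2 * n) * ((‖y - c‖ ^ 2) ^ n)⁻¹)

lemma sphereBarrier_eq {n : ℕ} (c : ES n) (r : ℝ) (y : ES n) :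
    sphereBarrier c r y = 2 * (1 - (r / ‖y - c‖) ^ (2 * n)) := by
  rw [sphereBarrier, div_pow, ← pow_mul, div_eq_mul_inv]

lemma sphereBarrier_nonneg {n : ℕ} {c : ES n} {r : ℝ} {y : ES n} (hr : 0 < r)
    (hy : r ≤ ‖y - c‖) : 0 ≤ sphereBarrier c r y := by
  rw [sphereBarrier_eq]
  have := pow_le_one₀ (n := 2 * n) (by positivity) ((div_le_one (hr.trans_le hy)).2 hy)
  linarith

lemma one_le_sphereBarrier {n : ℕ} {c : ES n} {r : ℝ} {y : ES n} (hn : 0 < n) (hr : 0 < r)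
    (hy : 2 * r ≤ ‖y - c‖) : 1 ≤ sphereBarrier c r y := by
  rw [sphereBarrier_eq]
  have h1 : r / ‖y - c‖ ≤ 1 / 2 := by
    rw [div_le_div_iff₀ (by linarith) two_pos]
    linarith
  have h0 : 0 ≤ r / ‖y - c‖ := by positivity
  have h2 := pow_le_of_le_one h0 (h1.trans (by norm_num)) (n := 2 * n) (by omega)
  linarith

lemma sphereBarrier_le {n : ℕ} {c : ES n} {r : ℝ} {y : ES n} (hr : 0 < r)
    (hy : r ≤ ‖y - c‖) : sphereBarrier c r y ≤ 4 * n / r * (‖y - c‖ - r) := by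
  rw [sphereBarrier_eq]
  have hpos : 0 < ‖y - c‖ := hr.trans_le hy
  have h0 : 0 ≤ r / ‖y - c‖ := by positivity
  have hb := one_add_mul_le_pow (a := r / ‖y - c‖ - 1) (by linarith) (2 * n)
  have hr1 : 1 - r / ‖y - c‖ ≤ (‖y - c‖ - r) / r := by
    have : 1 - r / ‖y - c‖ = (‖y - c‖ - r) / ‖y - c‖ := by field_simp
    rw [this]
    exact div_le_div_of_nonneg_left (by linarith) hr hy
  have h2 : 4 * (n : ℝ) * (1 - r / ‖y - c‖) ≤ 4 * n * ((‖y - c‖ - r) / r) := by gcongr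
  have e : 4 * (n : ℝ) / r * (‖y - c‖ - r) = 4 * n * ((‖y - c‖ - r) / r) := by ring
  rw [e]
  push_cast at hb
  rw [add_sub_cancel] at hb
  linarith

/-- If `u` is harmonic on an open set, then `σ u` minus the barrier has no interior maximum. -/
lemma not_isLocalMax_sub_sphereBarrier {n : ℕ} (hn : 0 < n) {u : ES n → ℝ} {s : Set (ES n)}
    (hs : IsOpen s) (hu : HarmOn u s) (σ : ℝ) {c x : ES n} {r : ℝ} (hr : 0 < r) (hx : x ∈ s)
    (hxc : x ≠ c) : ¬ IsLocalMax (fun y => σ * u y - sphereBarrier c r y) x := by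
  intro hmax
  set q : ℝ := ‖x - c‖ ^ 2 with hq
  have hq0 : 0 < q := by
    have := norm_pos_iff.2 (sub_ne_zero.2 hxc)
    positivity
  set R : ℝ := r ^ (2 * n) with hR
  have hR0 : 0 < R := by positivity
  have key : ∀ i : Fin n,
      σ * fderiv ℝ (fun y => fderiv ℝ u y (EuclideanSpace.single i 1)) x
        (EuclideanSpace.single i 1) ≤
      2 * R * (2 * n * (q - 2 * (n + 1) * ((x - c) i) ^ 2) * (q ^ (n + 2))⁻¹) := by
    intro i
    set e : ES n := EuclideanSpace.single i 1 with he
    have hline : ∀ t : ℝ, HasDerivAt (fun t : ℝ => x + t • e) e t := by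
      intro t
      simpa using ((hasDerivAt_id t).smul_const e).const_add x
    have htend : Tendsto (fun t : ℝ => x + t • e) (𝓝 0) (𝓝 x) := by
      simpa [ContinuousAt] using (hline 0).continuousAt
    have hmem : ∀ᶠ t : ℝ in 𝓝 0, x + t • e ∈ s := htend.eventually (hs.mem_nhds hx)
    have hua : ∀ᶠ t : ℝ in 𝓝 0, HasDerivAt (fun t : ℝ => σ * u (x + t • e))
        (σ * fderiv ℝ u (x + t • e) e) t := by
      filter_upwards [hmem] with t ht
      have hdiff : DifferentiableAt ℝ u (x + t • e) :=
        (hu.1.contDiffAt (hs.mem_nhds ht)).differentiableAt (by norm_num)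
      exact (hdiff.hasFDerivAt.comp_hasDerivAt t (hline t)).const_mul σ
    have hua' : HasDerivAt (fun t : ℝ => σ * fderiv ℝ u (x + t • e) e)
        (σ * fderiv ℝ (fun y => fderiv ℝ u y e) x e) 0 := by
      have h1 : DifferentiableAt ℝ (fderiv ℝ u) x :=
        ((hu.1.contDiffAt (hs.mem_nhds hx)).fderiv_right (m := 1) (by norm_num)).differentiableAt
          (by norm_num)
      have h2 : DifferentiableAt ℝ (fun y => fderiv ℝ u y e) x :=
        h1.clm_apply (differentiableAt_const e)
      have h3 : HasFDerivAt (fun y => fderiv ℝ u y e) (fderiv ℝ (fun y => fderiv ℝ u y e) x)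
          (x + (0 : ℝ) • e) := by simpa using h2.hasFDerivAt
      exact (h3.comp_hasDerivAt (0 : ℝ) (hline 0)).const_mul σ
    obtain ⟨hw, hw'⟩ := hasDerivAt_deriv_inv_pow_quadratic (p := (x - c) i) n hq0
    have hbar : ∀ t : ℝ, sphereBarrier c r (x + t • e) =
        2 + 2 * R * -((q + 2 * (x - c) i * t + t ^ 2) ^ n)⁻¹ := by
      intro t
      have hnorm : ‖x + t • e - c‖ ^ 2 = q + 2 * (x - c) i * t + t ^ 2 := by
        have h1 : x + t • e - c = (x - c) + t • e := by abel
        have h2 : ⟪x - c, t • e⟫ = t * (x - c) i := by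
          rw [real_inner_smul_right, he, EuclideanSpace.inner_single_right]
          simp
        have h3 : ‖t • e‖ ^ 2 = t ^ 2 := by
          rw [norm_smul, he, PiLp.norm_single]
          simp
        rw [h1, norm_add_sq_real, h2, h3]
        ring
      rw [sphereBarrier, hnorm]
      ring
    refine second_deriv_le_of_eventually_le hua
      (b := fun t : ℝ => (2 + 2 * R * -((q + 2 * (x - c) i * t + t ^ 2) ^ n)⁻¹) +
        (σ * u x - sphereBarrier c r x)) ?_ hua'
      (hw'.const_mul (2 * R)) ?_ ?_
    · filter_upwards [hw] with t ht
      exact ((ht.const_mul (2 * R)).const_add 2).add_const _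
    · filter_upwards [htend.eventually hmax] with t ht
      have := hbar t
      linarith
    · have := hbar 0
      simp only [zero_smul, add_zero] at this
      simp only [zero_smul, add_zero, ← this]
      ring
  have hsum := Finset.sum_le_sum fun i (_ : i ∈ Finset.univ) => key i
  rw [← Finset.mul_sum] at hsum
  have hlap := hu.2 x hx
  rw [lap] at hlap
  rw [hlap, mul_zero, ← Finset.mul_sum, ← Finset.sum_mul, ← Finset.mul_sum,
    Finset.sum_sub_distrib, ← Finset.mul_sum, ← EuclideanSpace.real_norm_sq_eq, ← hq] at hsum
  simp only [Finset.sum_const, Finset.card_univ, Fintype.card_fin, nsmul_eq_mul] at hsum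
  have hn' : (0 : ℝ) < n := by exact_mod_cast hn
  have : 0 < 2 * R * (2 * n * ((n + 2) * q) * (q ^ (n + 2))⁻¹) := by positivity
  have e : 2 * R * (2 * n * (n * q - 2 * (n + 1) * q) * (q ^ (n + 2))⁻¹) =
    -(2 * R * (2 * n * ((n + 2) * q) * (q ^ (n + 2))⁻¹)) := by ring
  rw [e] at hsum
  linarith

/-- A function bounded by the distance to the sphere on one side of it has bounded gradient. -/
lemma norm_gradient_le_of_abs_le {n : ℕ} {u : ES n → ℝ} {c x : ES n} {r M : ℝ} (hM : 0 ≤ M)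
    (hx : x ∈ sphere c r)
    (hu : ∀ᶠ y in 𝓝 x, r ≤ ‖y - c‖ → |u y| ≤ M * (‖y - c‖ - r)) : ‖gradient u x‖ ≤ M := by
  by_cases hdiff : DifferentiableAt ℝ u x
  swap
  · rw [gradient_eq_zero_of_not_differentiableAt hdiff, norm_zero]
    exact hM
  have hxr : ‖x - c‖ = r := by simpa [dist_eq_norm] using hx
  have hux : u x = 0 := by
    have := hu.self_of_nhds hxr.ge
    rw [hxr, sub_self, mul_zero] at this
    exact abs_nonpos_iff.1 this
  have key : ∀ v : ES n, 0 ≤ ⟪x - c, v⟫ → |⟪gradient u x, v⟫| ≤ M * ‖v‖ := by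
    intro v hv
    have hline : HasDerivAt (fun t : ℝ => x + t • v) v 0 := by
      simpa using ((hasDerivAt_id (0 : ℝ)).smul_const v).const_add x
    have hg : HasFDerivAt u (InnerProductSpace.toDual ℝ (ES n) (gradient u x))
        (x + (0 : ℝ) • v) := by
      simpa using hdiff.hasGradientAt.hasFDerivAt
    have hder : HasDerivAt (fun t : ℝ => u (x + t • v)) ⟪gradient u x, v⟫ 0 :=
      (hg.comp_hasDerivAt (0 : ℝ) hline).congr_deriv InnerProductSpace.toDual_apply_apply
    have hslope := hder.tendsto_slope_zero_right.abs
    refine le_of_tendsto hslope ?_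
    have htend : Tendsto (fun t : ℝ => x + t • v) (𝓝[>] 0) (𝓝 x) := by
      have := hline.continuousAt.tendsto
      simp only [zero_smul, add_zero] at this
      exact this.mono_left nhdsWithin_le_nhds
    filter_upwards [htend.eventually hu, self_mem_nhdsWithin] with t ht htpos
    rw [Set.mem_Ioi] at htpos
    have h1 : x + t • v - c = (x - c) + t • v := by abel
    have hge : r ≤ ‖x + t • v - c‖ := by
      refine le_of_sq_le_sq ?_ (norm_nonneg _)
      rw [h1, norm_add_sq_real, real_inner_smul_right, hxr]
      have : 0 ≤ t * ⟪x - c, v⟫ := mul_nonneg htpos.le hv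
      have := sq_nonneg ‖t • v‖
      linarith
    have hle : ‖x + t • v - c‖ ≤ r + t * ‖v‖ := by
      rw [h1]
      refine (norm_add_le _ _).trans_eq ?_
      rw [hxr, norm_smul, Real.norm_of_nonneg htpos.le]
    have hb : |u (x + t • v)| ≤ M * (t * ‖v‖) :=
      (ht hge).trans (mul_le_mul_of_nonneg_left (by linarith) hM)
    simp only [zero_add, zero_smul, add_zero, hux, sub_zero, smul_eq_mul, abs_mul, abs_inv,
      abs_of_pos htpos]
    rw [inv_mul_le_iff₀ htpos]
    linarith
  have hself : |⟪gradient u x, gradient u x⟫| ≤ M * ‖gradient u x‖ := by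
    rcases le_total 0 ⟪x - c, gradient u x⟫ with h | h
    · exact key _ h
    · have := key (-gradient u x) (by rw [inner_neg_right]; linarith)
      rwa [inner_neg_right, abs_neg, norm_neg] at this
  rw [real_inner_self_eq_norm_sq, abs_of_nonneg (sq_nonneg _), sq] at hself
  by_contra! hlt
  exact absurd hself (not_le.2 (mul_lt_mul_of_pos_right hlt (hM.trans_lt hlt)))

/-- Comparison with the barrier centered at the first of two excised balls. -/
lemma mul_le_sphereBarrier {n : ℕ} (hn : 0 < n) {c₁ c₂ : ES n} {r₁ r₂ L σ : ℝ} (hr₁ : 0 < r₁)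
    (hσ : σ ≤ 1) (hL : ‖c₁‖ + 2 * r₁ ≤ L) {u : ES n → ℝ}
    (hcont : ContinuousOn u (closedBall 0 L \ (ball c₁ r₁ ∪ ball c₂ r₂)))
    (hharm : HarmOn u (ball 0 L \ (closedBall c₁ r₁ ∪ closedBall c₂ r₂)))
    (h0 : ∀ x ∈ sphere c₁ r₁ ∪ sphere c₂ r₂, u x = 0) (h1 : ∀ x ∈ sphere 0 L, u x = 1)
    {y : ES n} (hy : y ∈ closedBall 0 L \ (ball c₁ r₁ ∪ ball c₂ r₂)) :
    σ * u y ≤ sphereBarrier c₁ r₁ y := by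
  set K : Set (ES n) := closedBall 0 L \ (ball c₁ r₁ ∪ ball c₂ r₂) with hK
  have hfar : ∀ z ∈ K, r₁ ≤ ‖z - c₁‖ := by
    intro z hz
    have : z ∉ ball c₁ r₁ := fun h => hz.2 (Or.inl h)
    rwa [mem_ball, dist_eq_norm, not_lt] at this
  have hKc : IsCompact K :=
    (isCompact_closedBall 0 L).diff (isOpen_ball.union isOpen_ball)
  have hbar : ContinuousOn (sphereBarrier c₁ r₁) K := by
    unfold sphereBarrier
    refine continuousOn_const.mul (continuousOn_const.sub (continuousOn_const.mul
      (ContinuousOn.inv₀ (by fun_prop) fun z hz => ?_)))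
    have := hr₁.trans_le (hfar z hz)
    positivity
  obtain ⟨x, hxK, hxmax⟩ := hKc.exists_isMaxOn ⟨y, hy⟩ ((continuousOn_const.mul hcont).sub hbar)
  have hxy : σ * u y - sphereBarrier c₁ r₁ y ≤ σ * u x - sphereBarrier c₁ r₁ x := hxmax hy
  suffices σ * u x ≤ sphereBarrier c₁ r₁ x by linarith
  by_cases hxu : u x = 0
  · rw [hxu, mul_zero]
    exact sphereBarrier_nonneg hr₁ (hfar x hxK)
  by_cases hxL : x ∈ sphere 0 L
  · rw [h1 x hxL, mul_one]
    refine hσ.trans (one_le_sphereBarrier hn hr₁ ?_)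
    have h2 := norm_sub_norm_le x c₁
    rw [mem_sphere_zero_iff_norm.1 hxL] at h2
    linarith
  exfalso
  set U : Set (ES n) := ball 0 L \ (closedBall c₁ r₁ ∪ closedBall c₂ r₂) with hU
  have hUo : IsOpen U := isOpen_ball.sdiff (isClosed_closedBall.union isClosed_closedBall)
  have hxU : x ∈ U := by
    refine ⟨lt_of_le_of_ne hxK.1 hxL, ?_⟩
    rintro (h | h)
    · exact hxu (h0 x (Or.inl (le_antisymm h (not_lt.1 fun h' => hxK.2 (Or.inl h')))))
    · exact hxu (h0 x (Or.inr (le_antisymm h (not_lt.1 fun h' => hxK.2 (Or.inr h')))))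
  have hUK : U ⊆ K := Set.sdiff_subset_sdiff ball_subset_closedBall
    (Set.union_subset_union ball_subset_closedBall ball_subset_closedBall)
  have hxc : x ≠ c₁ := by
    rintro rfl
    have := hfar x hxK
    rw [sub_self, norm_zero] at this
    linarith
  exact not_isLocalMax_sub_sphereBarrier hn hUo hharm σ hr₁ hxU hxc
    (hxmax.isLocalMax (mem_of_superset (hUo.mem_nhds hxU) hUK))

/-- Gradient bound on the first of two disjoint excised spheres. -/
lemma norm_gradient_le_on_sphere {n : ℕ} (hn : 0 < n) {c₁ c₂ : ES n} {r₁ r₂ L : ℝ} (hr₁ : 0 < r₁)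
    (hL : ‖c₁‖ + 2 * r₁ ≤ L) (hdist : r₁ + r₂ < dist c₁ c₂) {u : ES n → ℝ}
    (hcont : ContinuousOn u (closedBall 0 L \ (ball c₁ r₁ ∪ ball c₂ r₂)))
    (hharm : HarmOn u (ball 0 L \ (closedBall c₁ r₁ ∪ closedBall c₂ r₂)))
    (h0 : ∀ x ∈ sphere c₁ r₁ ∪ sphere c₂ r₂, u x = 0) (h1 : ∀ x ∈ sphere 0 L, u x = 1)
    {x : ES n} (hx : x ∈ sphere c₁ r₁) : ‖gradient u x‖ ≤ 4 * n / r₁ := by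
  refine norm_gradient_le_of_abs_le (by positivity) hx ?_
  have hxr : dist x c₁ = r₁ := hx
  have hxL : x ∈ ball (0 : ES n) L := by
    rw [mem_ball_zero_iff]
    have h2 := norm_sub_norm_le x c₁
    rw [← dist_eq_norm, hxr] at h2
    linarith
  have hx2 : x ∈ (closedBall c₂ r₂)ᶜ := by
    rw [Set.mem_compl_iff, mem_closedBall, not_le]
    have := dist_triangle_left c₁ c₂ x
    linarith
  filter_upwards [isOpen_ball.mem_nhds hxL, isClosed_closedBall.isOpen_compl.mem_nhds hx2]
    with y hyL hy2 hy
  have hyK : y ∈ closedBall 0 L \ (ball c₁ r₁ ∪ ball c₂ r₂) := by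
    refine ⟨ball_subset_closedBall hyL, ?_⟩
    rintro (h | h)
    · rw [mem_ball, dist_eq_norm] at h
      linarith
    · exact hy2 (ball_subset_closedBall h)
  refine le_trans (abs_le'.2 ⟨?_, ?_⟩) (sphereBarrier_le hr₁ hy)
  · simpa using mul_le_sphereBarrier hn hr₁ le_rfl hL hcont hharm h0 h1 hyK
  · simpa using mul_le_sphereBarrier (σ := -1) hn hr₁ (by norm_num) hL hcont hharm h0 h1 hyK

/-- **Lemma 4.4 (after Bao–Li–Yin).**
In `ℝⁿ` (`n ≥ 3`), with `D̃₁ = B_1((1+δ,0,…,0))`, `D̃₂ = B_d((−d−δ,0,…,0))` (`0 < d ≤ 1`),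
`Ω = B_4(0)`, and `ρ` the harmonic function in `Ω∖cl(D̃₁∪D̃₂)` vanishing on `∂D̃₁ ∪ ∂D̃₂`
and equal to `1` on `∂Ω`: there is `C > 0`, independent of `d` and `δ`, such that for all
sufficiently small `δ > 0`, `|∇ρ| ≤ C` on `∂D̃₁` and `|∇ρ| ≤ C/d` on `∂D̃₂`
(hence `|∇ρ| ≤ C/d` on `∂D̃₁ ∪ ∂D̃₂`). -/
theorem rho_gradient_bound (n : ℕ) (hn : 3 ≤ n) :
    ∃ C : ℝ, 0 < C ∧
      ∀ d : ℝ, 0 < d → d ≤ 1 → ∃ δ₀ : ℝ, 0 < δ₀ ∧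
        ∀ δ : ℝ, 0 < δ → δ < δ₀ →
          ∀ ρ : ES n → ℝ,
            ContinuousOn ρ (closedBall (0 : ES n) 4 \
              (ball (EuclideanSpace.single (⟨0, by omega⟩ : Fin n) (1 + δ) : ES n) 1 ∪
                ball (EuclideanSpace.single (⟨0, by omega⟩ : Fin n) (-(d + δ)) : ES n) d)) →
            HarmOn ρ (ball (0 : ES n) 4 \
              (closedBall (EuclideanSpace.single (⟨0, by omega⟩ : Fin n) (1 + δ) : ES n) 1 ∪
                closedBall (EuclideanSpace.single (⟨0, by omega⟩ : Fin n) (-(d + δ)) : ES n) d)) →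
            (∀ x ∈ sphere (EuclideanSpace.single (⟨0, by omega⟩ : Fin n) (1 + δ) : ES n) 1 ∪
                sphere (EuclideanSpace.single (⟨0, by omega⟩ : Fin n) (-(d + δ)) : ES n) d,
              ρ x = 0) →
            (∀ x ∈ sphere (0 : ES n) 4, ρ x = 1) →
              (∀ x ∈ sphere (EuclideanSpace.single (⟨0, by omega⟩ : Fin n) (1 + δ) : ES n) 1,
                ‖gradient ρ x‖ ≤ C) ∧
              (∀ x ∈ sphere (EuclideanSpace.single (⟨0, by omega⟩ : Fin n) (-(d + δ)) : ES n) d,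
                ‖gradient ρ x‖ ≤ C / d) := by
  have hn0 : 0 < n := by omega
  have hn' : (0 : ℝ) < n := by exact_mod_cast hn0
  refine ⟨4 * n, by positivity, fun d hd hd1 => ⟨1 / 2, by norm_num, ?_⟩⟩
  intro δ hδ hδ2 ρ hcont hharm h0 h1
  set e : Fin n := ⟨0, by omega⟩ with he
  have hc₁ : ‖(EuclideanSpace.single e (1 + δ) : ES n)‖ = 1 + δ := by
    rw [PiLp.norm_single, Real.norm_of_nonneg (by linarith)]
  have hc₂ : ‖(EuclideanSpace.single e (-(d + δ)) : ES n)‖ = d + δ := by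
    rw [PiLp.norm_single, norm_neg, Real.norm_of_nonneg (by linarith)]
  have hdist : dist (EuclideanSpace.single e (1 + δ) : ES n) (EuclideanSpace.single e (-(d + δ))) =
      1 + d + 2 * δ := by
    rw [PiLp.dist_single_same, Real.dist_eq, abs_of_pos (by linarith)]
    ring
  constructor
  · intro x hx
    simpa using norm_gradient_le_on_sphere hn0 one_pos (by linarith) (by linarith) hcont hharm
      h0 h1 hx
  · intro x hx
    rw [Set.union_comm] at hcont hharm h0
    exact norm_gradient_le_on_sphere hn0 hd (by linarith) (by rw [dist_comm]; linarith) hcont hharm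
      h0 h1 hx
end
end
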